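/- arXiv:1509.01770 — 2 statements merged into one kernel-verified Lean document; each statement's English description precedes it below -/
import Mathlib

section
/- Let G ∈ ℝ^{n₁×n₂} be a random matrix whose entries are independent standard Gaussian. Then the expected operator (spectral) norm satisfies E‖G‖_op ≤ √n₁ + √n₂. -/
open MeasureTheory ProbabilityTheory Real BigOperators

noncomputable section

/-- Operator (spectral) norm of a real matrix. -/
def opNorm {p q : Type*} [Fintype p] [Fintype q] [DecidableEq q]
    (A : Matrix p q ℝ) : ℝ :=
  ‖LinearMap.toContinuousLinearMap (Matrix.toEuclideanLin A)‖

end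

lemma abs_taylor_two_le {h h₁ h₂ h₃ : ℝ → ℝ} {K : ℝ}
    (d₁ : ∀ s, HasDerivAt h (h₁ s) s) (d₂ : ∀ s, HasDerivAt h₁ (h₂ s) s)
    (d₃ : ∀ s, HasDerivAt h₂ (h₃ s) s) (hK : ∀ s, |h₃ s| ≤ K) :
    |h 1 - h 0 - h₁ 0 - h₂ 0 / 2| ≤ K := by
  have hK0 : 0 ≤ K := (abs_nonneg _).trans (hK 0)
  have key : ∀ {f f' : ℝ → ℝ}, (∀ s, HasDerivAt f (f' s) s) → f 0 = 0 →
      (∀ s ∈ Set.Icc (0 : ℝ) 1, |f' s| ≤ K) → ∀ s ∈ Set.Icc (0 : ℝ) 1, |f s| ≤ K := by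
    intro f f' hf h0 hb s hs
    have := (convex_Icc (0 : ℝ) 1).norm_image_sub_le_of_norm_hasDerivWithin_le
      (fun x _ => (hf x).hasDerivWithinAt) (fun x hx => hb x hx) (Set.left_mem_Icc.2 zero_le_one) hs
    rw [h0, sub_zero, sub_zero, Real.norm_eq_abs, Real.norm_eq_abs] at this
    refine this.trans (mul_le_of_le_one_right hK0 ?_)
    rw [abs_of_nonneg hs.1]; exact hs.2
  have k₂ := key (f := fun s => h₂ s - h₂ 0) (fun s => (d₃ s).sub_const _) (by simp)
    (fun s _ => hK s)
  have k₁ := key (f := fun s => h₁ s - h₁ 0 - s * h₂ 0) (f' := fun s => h₂ s - h₂ 0)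
    (fun s => by
      refine (((d₂ s).sub_const (h₁ 0)).sub
        ((hasDerivAt_id s).mul_const (h₂ 0))).congr_deriv ?_
      simp) (by simp) k₂
  have k₀ := key (f := fun s => h s - h 0 - s * h₁ 0 - s ^ 2 * (h₂ 0 / 2))
    (f' := fun s => h₁ s - h₁ 0 - s * h₂ 0)
    (fun s => by
      have := (((d₁ s).sub_const (h 0)).sub ((hasDerivAt_id s).mul_const (h₁ 0))).sub
        (((hasDerivAt_id s).pow 2).mul_const (h₂ 0 / 2))
      refine this.congr_deriv ?_
      simp; ring) (by simp) k₁ 1 (by simp)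
  simpa using k₀

lemma sum_mul_sq_sub_sq_eq {ι : Type*} [Fintype ι] (w d : ι → ℝ) (h : ∑ i, w i ≠ 0) :
    (∑ i, w i * d i ^ 2) / (∑ i, w i) - ((∑ i, w i * d i) / (∑ i, w i)) ^ 2
      = (∑ i, ∑ j, w i * w j * (d i - d j) ^ 2) / (2 * (∑ i, w i) ^ 2) := by
  have e : ∑ i, ∑ j, w i * w j * (d i - d j) ^ 2
      = 2 * ((∑ i, w i) * ∑ i, w i * d i ^ 2) - 2 * ((∑ i, w i * d i) * ∑ i, w i * d i) := by
    have e1 : (∑ i, w i) * ∑ i, w i * d i ^ 2 = ∑ i, ∑ j, w i * (w j * d j ^ 2) :=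
      Finset.sum_mul_sum _ _ _ _
    have e2 : (∑ i, w i) * ∑ i, w i * d i ^ 2 = ∑ i, ∑ j, w i * d i ^ 2 * w j := by
      rw [mul_comm]; exact Finset.sum_mul_sum _ _ _ _
    rw [two_mul]
    nth_rewrite 1 [e1]
    rw [e2, Finset.sum_mul_sum, Finset.mul_sum]
    simp only [Finset.mul_sum, ← Finset.sum_add_distrib, ← Finset.sum_sub_distrib]
    exact Finset.sum_congr rfl fun i _ => Finset.sum_congr rfl fun j _ => by ring
  rw [e]
  field_simp

section LogSumExp

variable {ι : Type*} [Fintype ι] [Nonempty ι]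

lemma sum_mul_exp_pos {w : ι → ℝ} (hw : ∀ i, 0 < w i) (d : ι → ℝ) (s : ℝ) :
    0 < ∑ i, w i * exp (s * d i) :=
  Finset.sum_pos (fun i _ => mul_pos (hw i) (exp_pos _)) Finset.univ_nonempty

/-- Second order expansion of a weighted log-sum-exp with a cubic remainder. -/
lemma abs_log_sum_exp_sub_le {w : ι → ℝ} (hw : ∀ i, 0 < w i) {d : ι → ℝ} {M : ℝ}
    (hd : ∀ i, |d i| ≤ M) :
    |log (∑ i, w i * exp (d i)) - log (∑ i, w i) - (∑ i, w i * d i) / (∑ i, w i)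
      - ((∑ i, w i * d i ^ 2) / (∑ i, w i) - ((∑ i, w i * d i) / (∑ i, w i)) ^ 2) / 2|
      ≤ 6 * M ^ 3 := by
  have hM : 0 ≤ M := (abs_nonneg _).trans (hd (Classical.arbitrary ι))
  set S : ℕ → ℝ → ℝ := fun k s => ∑ i, w i * exp (s * d i) * d i ^ k with hS
  have S0 : ∀ s, 0 < S 0 s := fun s => by simpa [hS] using sum_mul_exp_pos hw d s
  have dS : ∀ k s, HasDerivAt (S k) (S (k + 1) s) s := by
    intro k s
    refine (HasDerivAt.fun_sum (u := Finset.univ) (A' := fun i => w i * exp (s * d i) * d i ^ (k + 1))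
      fun i _ => ?_)
    have := ((((hasDerivAt_id s).mul_const (d i)).exp).const_mul (w i)).mul_const (d i ^ k)
    refine this.congr_deriv ?_
    simp; ring
  have bS : ∀ k s, |S k s / S 0 s| ≤ M ^ k := by
    intro k s
    rw [abs_div, abs_of_pos (S0 s), div_le_iff₀ (S0 s)]
    simp only [hS, pow_zero, mul_one, Finset.mul_sum]
    refine (Finset.abs_sum_le_sum_abs _ _).trans (Finset.sum_le_sum fun i _ => ?_)
    rw [abs_mul, abs_of_pos (mul_pos (hw i) (exp_pos _)), abs_pow, mul_comm]
    exact mul_le_mul_of_nonneg_right (pow_le_pow_left₀ (abs_nonneg _) (hd i) _)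
      (mul_pos (hw i) (exp_pos _)).le
  have dq : ∀ k s, HasDerivAt (fun s => S k s / S 0 s)
      (S (k + 1) s / S 0 s - (S k s / S 0 s) * (S 1 s / S 0 s)) s := by
    intro k s
    refine ((dS k s).div (dS 0 s) (S0 s).ne').congr_deriv ?_
    have := (S0 s).ne'
    field_simp
  have main := abs_taylor_two_le (h := fun s => log (S 0 s)) (h₁ := fun s => S 1 s / S 0 s)
    (h₂ := fun s => S 2 s / S 0 s - (S 1 s / S 0 s) ^ 2)
    (h₃ := fun s => S 3 s / S 0 s - (S 2 s / S 0 s) * (S 1 s / S 0 s)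
      - 2 * (S 1 s / S 0 s) * (S 2 s / S 0 s - (S 1 s / S 0 s) * (S 1 s / S 0 s)))
    (K := 6 * M ^ 3) (fun s => (dS 0 s).log (S0 s).ne') (fun s => by simpa [sq] using dq 1 s)
    (fun s => by
      refine ((dq 2 s).sub ((dq 1 s).pow 2)).congr_deriv ?_
      simp)
    (fun s => by
      have h1 := bS 1 s
      have h2 := bS 2 s
      have h3 := bS 3 s
      generalize S 1 s / S 0 s = x at *
      generalize S 2 s / S 0 s = y at *
      generalize S 3 s / S 0 s = z at *
      rw [pow_one] at h1
      have h4 : |x * y| ≤ M ^ 3 := by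
        rw [abs_mul, pow_succ' M 2]; exact mul_le_mul h1 h2 (abs_nonneg _) hM
      have h5 : |x ^ 3| ≤ M ^ 3 := by
        rw [abs_pow]; exact pow_le_pow_left₀ (abs_nonneg _) h1 _
      rw [abs_le] at *
      constructor <;> nlinarith [h3.1, h3.2, h4.1, h4.2, h5.1, h5.2])
  simpa [hS] using main

/-- The log-sum-exp function on a finite-dimensional Euclidean space. -/
noncomputable def logSumExp (x : EuclideanSpace ℝ ι) : ℝ := log (∑ i, exp (x i))

lemma continuous_logSumExp : Continuous (logSumExp (ι := ι)) := by
  unfold logSumExp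
  refine Continuous.log (continuous_finsetSum _ fun i _ => by fun_prop) fun x => ?_
  exact (Finset.sum_pos (fun i _ => exp_pos _) Finset.univ_nonempty).ne'

lemma le_logSumExp (x : EuclideanSpace ℝ ι) (i : ι) : x i ≤ logSumExp x := by
  rw [logSumExp, le_log_iff_exp_le (Finset.sum_pos (fun i _ => exp_pos _) Finset.univ_nonempty)]
  exact Finset.single_le_sum (f := fun i => exp (x i)) (fun i _ => (exp_pos _).le)
    (Finset.mem_univ i)

lemma logSumExp_le {x : EuclideanSpace ℝ ι} {M : ℝ} (h : ∀ i, x i ≤ M) :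
    logSumExp x ≤ log (Fintype.card ι) + M := by
  have hc : (0 : ℝ) < Fintype.card ι := by exact_mod_cast Fintype.card_pos
  rw [logSumExp, log_le_iff_le_exp (Finset.sum_pos (fun i _ => exp_pos _) Finset.univ_nonempty),
    exp_add, exp_log hc]
  refine (Finset.sum_le_sum fun i _ => exp_le_exp.2 (h i)).trans_eq ?_
  simp

lemma abs_logSumExp_le (x : EuclideanSpace ℝ ι) :
    |logSumExp x| ≤ log (Fintype.card ι) + ‖x‖ := by
  have hx : ∀ i, |x i| ≤ ‖x‖ := fun i => PiLp.norm_apply_le x i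
  have hc : (0 : ℝ) ≤ log (Fintype.card ι) := log_natCast_nonneg _
  rw [abs_le]
  refine ⟨?_, logSumExp_le fun i => (le_abs_self _).trans (hx i)⟩
  have i := Classical.arbitrary ι
  linarith [le_logSumExp x i, neg_abs_le (x i), hx i]

end LogSumExp

section GaussianComparison

lemma integrable_sq_apply_sub {ι : Type*} [Fintype ι] {μ : Measure (EuclideanSpace ℝ ι)} [IsGaussian μ]
    (i j : ι) : Integrable (fun y => (y i - y j) ^ 2) μ := by
  refine Integrable.mono' (g := fun y => 4 * ‖y‖ ^ 2)
    ((IsGaussian.memLp_two_id (μ := μ)).integrable_norm_pow (by norm_num) |>.const_mul 4)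
    (by fun_prop) (ae_of_all _ fun y => ?_)
  have hi : |y i| ≤ ‖y‖ := PiLp.norm_apply_le y i
  have hj : |y j| ≤ ‖y‖ := PiLp.norm_apply_le y j
  rw [Real.norm_eq_abs, abs_pow, show 4 * ‖y‖ ^ 2 = (2 * ‖y‖) ^ 2 by ring]
  refine pow_le_pow_left₀ (abs_nonneg _) ?_ _
  linarith [abs_sub (y i) (y j)]

variable {ι : Type*} [Fintype ι] [Nonempty ι]

lemma integrable_logSumExp (μ : Measure (EuclideanSpace ℝ ι)) [IsGaussian μ] :
    Integrable logSumExp μ := by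
  refine Integrable.mono' (g := fun x => log (Fintype.card ι) + ‖x‖)
    ((integrable_const _).add IsGaussian.integrable_id.norm)
    continuous_logSumExp.aestronglyMeasurable (ae_of_all _ abs_logSumExp_le)

lemma integrable_logSumExp_add_smul (μ : Measure (EuclideanSpace ℝ ι)) [IsGaussian μ]
    (x : EuclideanSpace ℝ ι) (a : ℝ) : Integrable (fun y => logSumExp (x + a • y)) μ := by
  refine Integrable.mono' (g := fun y => log (Fintype.card ι) + (‖x‖ + |a| * ‖y‖))
    ((integrable_const _).add ((integrable_const _).add
      (IsGaussian.integrable_id.norm.const_mul _)))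
    (continuous_logSumExp.comp (by fun_prop)).aestronglyMeasurable (ae_of_all _ fun y => ?_)
  refine (abs_logSumExp_le _).trans ?_
  have := norm_add_le x (a • y)
  rw [norm_smul, Real.norm_eq_abs] at this
  linarith

/-- The second order expansion of `∫ logSumExp (x + a • y) ∂μ` in `a`, for a centered Gaussian
measure `μ`, with a remainder uniform in `x`. -/
lemma abs_integral_logSumExp_sub_le (μ : Measure (EuclideanSpace ℝ ι)) [IsGaussian μ]
    (hμ : ∫ y, y ∂μ = 0) (x : EuclideanSpace ℝ ι) {a : ℝ} (ha : 0 ≤ a) :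
    |∫ y, logSumExp (x + a • y) ∂μ - (logSumExp x + a ^ 2 *
      ((∑ i, ∑ j, exp (x i) * exp (x j) * ∫ y, (y i - y j) ^ 2 ∂μ) /
        (4 * (∑ i, exp (x i)) ^ 2)))| ≤ a ^ 3 * (6 * ∫ y, ‖y‖ ^ 3 ∂μ) := by
  have hZ : 0 < ∑ i, exp (x i) := Finset.sum_pos (fun i _ => exp_pos _) Finset.univ_nonempty
  set Q : EuclideanSpace ℝ ι → ℝ := fun y =>
    (∑ i, ∑ j, exp (x i) * exp (x j) * (y i - y j) ^ 2) / (4 * (∑ i, exp (x i)) ^ 2) with hQ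
  have iQ : Integrable Q μ := (integrable_finsetSum _ fun i _ => integrable_finsetSum _ fun j _ =>
    (integrable_sq_apply_sub i j).const_mul _).div_const _
  have eQ : ∫ y, Q y ∂μ = (∑ i, ∑ j, exp (x i) * exp (x j) * ∫ y, (y i - y j) ^ 2 ∂μ) /
        (4 * (∑ i, exp (x i)) ^ 2) := by
    rw [hQ, integral_div, integral_finsetSum]
    · congr 1
      refine Finset.sum_congr rfl fun i _ => ?_
      rw [integral_finsetSum]
      · exact Finset.sum_congr rfl fun j _ => integral_const_mul _ _
      · exact fun j _ => (integrable_sq_apply_sub i j).const_mul _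
    · exact fun i _ => integrable_finsetSum _ fun j _ => (integrable_sq_apply_sub i j).const_mul _
  have iy : ∀ i, Integrable (fun y : EuclideanSpace ℝ ι => y i) μ := fun i =>
    (EuclideanSpace.proj i : EuclideanSpace ℝ ι →L[ℝ] ℝ).integrable_comp IsGaussian.integrable_id
  have cy : ∀ i, ∫ y, y i ∂μ = 0 := fun i => by
    have := (EuclideanSpace.proj i : EuclideanSpace ℝ ι →L[ℝ] ℝ).integral_comp_comm
      (IsGaussian.integrable_id (μ := μ))
    simpa [hμ] using this
  set L : EuclideanSpace ℝ ι → ℝ := fun y =>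
    (∑ i, exp (x i) * y i) / (∑ i, exp (x i)) with hL
  have iL : Integrable L μ :=
    (integrable_finsetSum _ fun i _ => (iy i).const_mul _).div_const _
  have eL : ∫ y, L y ∂μ = 0 := by
    rw [hL, integral_div, integral_finsetSum _ fun i _ => (iy i).const_mul _]
    simp [integral_const_mul, cy]
  have i3 : Integrable (fun y => ‖y‖ ^ 3) μ :=
    (IsGaussian.memLp_id μ 3 (by norm_num)).integrable_norm_pow (by norm_num)
  have key : ∀ y, |logSumExp (x + a • y) - (logSumExp x + (a * L y + a ^ 2 * Q y))|
      ≤ a ^ 3 * (6 * ‖y‖ ^ 3) := by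
    intro y
    have h := abs_log_sum_exp_sub_le (w := fun i => exp (x i)) (fun i => exp_pos _)
      (d := fun i => a * y i) (M := a * ‖y‖) (fun i => by
        rw [abs_mul, abs_of_nonneg ha]
        exact mul_le_mul_of_nonneg_left (PiLp.norm_apply_le y i) ha)
    rw [sum_mul_sq_sub_sq_eq _ _ hZ.ne'] at h
    have e1 : logSumExp (x + a • y) = log (∑ i, exp (x i) * exp (a * y i)) := by
      simp [logSumExp, exp_add]
    have e2 : (∑ i, exp (x i) * (a * y i)) / ∑ i, exp (x i) = a * L y := by
      rw [hL, ← mul_div_assoc, Finset.mul_sum]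
      congr 1; exact Finset.sum_congr rfl fun i _ => by ring
    have e3 : (∑ i, ∑ j, exp (x i) * exp (x j) * (a * y i - a * y j) ^ 2) /
        (2 * (∑ i, exp (x i)) ^ 2) / 2 = a ^ 2 * Q y := by
      have : ∑ i, ∑ j, exp (x i) * exp (x j) * (a * y i - a * y j) ^ 2
          = a ^ 2 * ∑ i, ∑ j, exp (x i) * exp (x j) * (y i - y j) ^ 2 := by
        simp only [Finset.mul_sum]
        exact Finset.sum_congr rfl fun i _ => Finset.sum_congr rfl fun j _ => by ring
      rw [this, hQ, div_div]; ring
    rw [e2, e3, ← e1] at h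
    rw [show a ^ 3 * (6 * ‖y‖ ^ 3) = 6 * (a * ‖y‖) ^ 3 by ring]
    have e4 : logSumExp x = log (∑ i, exp (x i)) := rfl
    rw [← e4] at h
    convert h using 2
    ring
  have iE : Integrable (fun y => logSumExp x + (a * L y + a ^ 2 * Q y)) μ :=
    (integrable_const _).add ((iL.const_mul _).add (iQ.const_mul _))
  have e : ∫ y, logSumExp x + (a * L y + a ^ 2 * Q y) ∂μ
      = logSumExp x + a ^ 2 * ∫ y, Q y ∂μ := by
    have iLQ : Integrable (fun y => a * L y + a ^ 2 * Q y) μ :=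
      (iL.const_mul a).add (iQ.const_mul (a ^ 2))
    rw [integral_add (integrable_const _) iLQ,
      integral_add (iL.const_mul a) (iQ.const_mul (a ^ 2)), integral_const_mul,
      integral_const_mul, eL]
    simp
  rw [← eQ, ← e, ← integral_sub (integrable_logSumExp_add_smul μ x a) iE,
    ← integral_const_mul, ← integral_const_mul]
  exact abs_integral_le_integral_abs.trans (integral_mono
    ((integrable_logSumExp_add_smul μ x a).sub iE).abs ((i3.const_mul _).const_mul _) key)

/-- One step of the comparison: the increments of `μ` being smaller than those of `ν`, a small
perturbation by `μ` increases `logSumExp` by less than one by `ν`, up to a cubic error. -/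
lemma integral_logSumExp_add_smul_le {μ ν : Measure (EuclideanSpace ℝ ι)} [IsGaussian μ]
    [IsGaussian ν] (hμ : ∫ y, y ∂μ = 0) (hν : ∫ y, y ∂ν = 0)
    (h : ∀ i j, ∫ y, (y i - y j) ^ 2 ∂μ ≤ ∫ y, (y i - y j) ^ 2 ∂ν)
    (x : EuclideanSpace ℝ ι) {a : ℝ} (ha : 0 ≤ a) :
    ∫ y, logSumExp (x + a • y) ∂μ ≤ ∫ y, logSumExp (x + a • y) ∂ν
      + a ^ 3 * (6 * ∫ y, ‖y‖ ^ 3 ∂μ + 6 * ∫ y, ‖y‖ ^ 3 ∂ν) := by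
  have h₁ := (abs_le.1 (abs_integral_logSumExp_sub_le μ hμ x ha)).2
  have h₂ := (abs_le.1 (abs_integral_logSumExp_sub_le ν hν x ha)).1
  have h₃ : a ^ 2 * ((∑ i, ∑ j, exp (x i) * exp (x j) * ∫ y, (y i - y j) ^ 2 ∂μ) /
        (4 * (∑ i, exp (x i)) ^ 2)) ≤
      a ^ 2 * ((∑ i, ∑ j, exp (x i) * exp (x j) * ∫ y, (y i - y j) ^ 2 ∂ν) /
        (4 * (∑ i, exp (x i)) ^ 2)) := by
    gcongr a ^ 2 * (?_ / _)
    exact Finset.sum_le_sum fun i _ => Finset.sum_le_sum fun j _ =>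
      mul_le_mul_of_nonneg_left (h i j) (by positivity)
  linarith

lemma integral_logSumExp_conv_le {μ ν ρ : Measure (EuclideanSpace ℝ ι)} [IsGaussian μ]
    [IsGaussian ν] [IsGaussian ρ] {c : ℝ}
    (h : ∀ x, ∫ y, logSumExp (x + y) ∂μ ≤ ∫ y, logSumExp (x + y) ∂ν + c) :
    ∫ x, logSumExp x ∂(ρ ∗ μ) ≤ ∫ x, logSumExp x ∂(ρ ∗ ν) + c := by
  have hint : ∀ (σ : Measure (EuclideanSpace ℝ ι)) [IsGaussian σ],
      Integrable (fun x => ∫ y, logSumExp (x + y) ∂σ) ρ := by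
    intro σ _
    have := integrable_logSumExp (ρ ∗ σ)
    rw [Measure.conv, integrable_map_measure
      continuous_logSumExp.aestronglyMeasurable (by fun_prop)] at this
    exact this.integral_prod_left
  rw [integral_conv (integrable_logSumExp (ρ ∗ μ)), integral_conv (integrable_logSumExp (ρ ∗ ν))]
  refine (integral_mono (hint μ) ((hint ν).add (integrable_const c)) h).trans_eq ?_
  rw [integral_add' (hint ν) (integrable_const c)]
  simp

end GaussianComparison

section Scaling

variable {E : Type*} [NormedAddCommGroup E] [InnerProductSpace ℝ E] [FiniteDimensional ℝ E]
  [MeasurableSpace E] [BorelSpace E]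

instance isGaussian_map_smul (μ : Measure E) [IsGaussian μ] (a : ℝ) :
    IsGaussian (μ.map (a • ·)) :=
  inferInstanceAs (IsGaussian (μ.map (a • ContinuousLinearMap.id ℝ E)))

lemma map_smul_conv_map_smul {μ : Measure E} [IsGaussian μ] (hμ : ∫ y, y ∂μ = 0) {a b c : ℝ}
    (h : a ^ 2 + b ^ 2 = c ^ 2) :
    (μ.map (a • ·)) ∗ (μ.map (b • ·)) = μ.map (c • ·) := by
  have hμ' : μ[id] = 0 := hμ
  apply Measure.ext_of_charFun
  ext t
  rw [charFun_conv, charFun_map_smul, charFun_map_smul, charFun_map_smul,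
    IsGaussian.charFun_eq', IsGaussian.charFun_eq', IsGaussian.charFun_eq', ← Complex.exp_add, hμ']
  congr 1
  have hC : (c : ℂ) ^ 2 = a ^ 2 + b ^ 2 := by exact_mod_cast h.symm
  simp
  linear_combination (covarianceBilin μ t t : ℂ) / 2 * hC

end Scaling

/-- **Sudakov–Fernique comparison** for the log-sum-exp of centered Gaussian vectors. -/
theorem integral_logSumExp_le_of_increments {ι : Type*} [Fintype ι] [Nonempty ι]
    {μ ν : Measure (EuclideanSpace ℝ ι)} [IsGaussian μ] [IsGaussian ν]
    (hμ : ∫ y, y ∂μ = 0) (hν : ∫ y, y ∂ν = 0)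
    (h : ∀ i j, ∫ y, (y i - y j) ^ 2 ∂μ ≤ ∫ y, (y i - y j) ^ 2 ∂ν) :
    ∫ y, logSumExp y ∂μ ≤ ∫ y, logSumExp y ∂ν := by
  set C := 6 * ∫ y, ‖y‖ ^ 3 ∂μ + 6 * ∫ y, ‖y‖ ^ 3 ∂ν with hC
  have hone : ∀ (σ : Measure (EuclideanSpace ℝ ι)), σ.map ((1 : ℝ) • ·) = σ := by
    intro σ; simp
  have hmap : ∀ (σ : Measure (EuclideanSpace ℝ ι)) (a : ℝ) (x : EuclideanSpace ℝ ι),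
      ∫ y, logSumExp (x + y) ∂(σ.map (a • ·)) = ∫ y, logSumExp (x + a • y) ∂σ := fun σ a x =>
    integral_map (by fun_prop)
      (continuous_logSumExp.comp (by fun_prop)).aestronglyMeasurable
  have bound : ∀ m : ℕ, 0 < m →
      ∫ y, logSumExp y ∂μ ≤ ∫ y, logSumExp y ∂ν + C * √(1 / m) := by
    intro m hm
    have hm' : (0 : ℝ) < m := by exact_mod_cast hm
    set a : ℝ := √(1 / m) with ha
    have ha2 : a ^ 2 = 1 / m := sq_sqrt (by positivity)
    have ha0 : 0 ≤ a := sqrt_nonneg _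
    have step : ∀ k, k ≤ m → ∫ y, logSumExp y ∂((ν.map (√(1 - k / m) • ·)) ∗ (μ.map (√(k / m) • ·)))
        ≤ ∫ y, logSumExp y ∂ν + k * (a ^ 3 * C) := by
      intro k
      induction k with
      | zero =>
        intro _
        simp
      | succ k ih =>
        intro hk
        have hk' : (k : ℝ) + 1 ≤ m := by exact_mod_cast hk
        have e1 : μ.map (√(((k + 1 : ℕ) : ℝ) / m) • ·)
            = (μ.map (√(k / m) • ·)) ∗ (μ.map (a • ·)) := by
          refine (map_smul_conv_map_smul hμ ?_).symm
          rw [sq_sqrt (by positivity), ha2, sq_sqrt (by positivity)]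
          push_cast; ring
        have hnn : 0 ≤ 1 - ((k + 1 : ℕ) : ℝ) / m := by
          rw [sub_nonneg, div_le_one hm']; exact_mod_cast hk
        have e2 : ν.map (√(1 - k / m) • ·)
            = (ν.map (√(1 - ((k + 1 : ℕ) : ℝ) / m) • ·)) ∗ (ν.map (a • ·)) := by
          refine (map_smul_conv_map_smul hν ?_).symm
          rw [sq_sqrt hnn, ha2, sq_sqrt]
          · push_cast; ring
          · rw [sub_nonneg, div_le_one hm']; linarith
        set ρ := (ν.map (√(1 - ((k + 1 : ℕ) : ℝ) / m) • ·)) ∗ (μ.map (√(k / m) • ·)) with hρ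
        have key := integral_logSumExp_conv_le (ρ := ρ) (μ := μ.map (a • ·))
          (ν := ν.map (a • ·)) (c := a ^ 3 * C) fun x => by
            rw [hmap, hmap]; exact integral_logSumExp_add_smul_le hμ hν h x ha0
        rw [e1, ← Measure.conv_assoc]
        refine key.trans ?_
        have e3 : ρ ∗ (ν.map (a • ·)) = (ν.map (√(1 - k / m) • ·)) ∗ (μ.map (√(k / m) • ·)) := by
          rw [hρ, e2, Measure.conv_assoc, Measure.conv_assoc,
            Measure.conv_comm (μ.map (√(k / m) • ·))]
        rw [e3]
        have := ih (by omega)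
        push_cast
        linarith
    have hfin := step m le_rfl
    have h0 : ν.map ((0 : ℝ) • ·) = Measure.dirac 0 := by
      simp [Measure.map_const]
    rw [div_self hm'.ne', sub_self, sqrt_zero, sqrt_one, h0, hone, Measure.dirac_zero_conv] at hfin
    refine hfin.trans_eq ?_
    have : (m : ℝ) * (a ^ 3 * C) = C * a := by
      rw [pow_succ, ha2]; field_simp
    rw [this]
  have hlim : Filter.Tendsto (fun m : ℕ => ∫ y, logSumExp y ∂ν + C * √(1 / (m : ℝ))) Filter.atTop
      (nhds (∫ y, logSumExp y ∂ν + C * √0)) :=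
    ((continuous_sqrt.tendsto 0).comp tendsto_one_div_atTop_nhds_zero_nat).const_mul C
      |>.const_add _
  rw [sqrt_zero, mul_zero, add_zero] at hlim
  exact ge_of_tendsto hlim (Filter.eventually_atTop.2 ⟨1, fun m hm => bound m hm⟩)

section StdGaussian

open scoped RealInnerProductSpace

variable {E F : Type*} [NormedAddCommGroup E] [InnerProductSpace ℝ E] [FiniteDimensional ℝ E]
  [MeasurableSpace E] [BorelSpace E] [NormedAddCommGroup F] [InnerProductSpace ℝ F]
  [FiniteDimensional ℝ F] [MeasurableSpace F] [BorelSpace F]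

/-- The continuous linear map `x ↦ (⟪a i, x⟫)ᵢ`. -/
noncomputable def innerFamily {E ι : Type*} [NormedAddCommGroup E] [InnerProductSpace ℝ E]
    (a : ι → E) : E →L[ℝ] EuclideanSpace ℝ ι :=
  (EuclideanSpace.equiv ι ℝ).symm.toContinuousLinearMap.comp
    (ContinuousLinearMap.pi fun i => innerSL ℝ (a i))

lemma innerFamily_apply {E ι : Type*} [NormedAddCommGroup E] [InnerProductSpace ℝ E]
    (a : ι → E) (x : E) (i : ι) : innerFamily a x i = ⟪a i, x⟫ := rfl

lemma integral_inner_sq_stdGaussian (a : E) : ∫ x, ⟪a, x⟫ ^ 2 ∂(stdGaussian E) = ‖a‖ ^ 2 := by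
  have h := variance_dual_stdGaussian (innerSL ℝ a)
  rw [variance_of_integral_eq_zero (by fun_prop)
    (integral_strongDual_stdGaussian (innerSL ℝ a))] at h
  simpa using h

variable {ι : Type*} [Fintype ι]

lemma integral_map_innerFamily (a : ι → E) :
    ∫ y, y ∂((stdGaussian E).map (innerFamily a)) = 0 := by
  rw [integral_map (by fun_prop) (by fun_prop),
    (innerFamily a).integral_comp_comm IsGaussian.integrable_fun_id]
  simp

lemma integral_sq_sub_map_innerFamily (a : ι → E) (i j : ι) :
    ∫ y, (y i - y j) ^ 2 ∂((stdGaussian E).map (innerFamily a)) = ‖a i - a j‖ ^ 2 := by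
  rw [integral_map (by fun_prop) (by fun_prop), ← integral_inner_sq_stdGaussian]
  simp [innerFamily_apply, inner_sub_left]

/-- **Sudakov–Fernique comparison** for families of inner products with standard Gaussian
vectors. -/
theorem integral_logSumExp_innerFamily_le [Nonempty ι] {a : ι → E} {b : ι → F}
    (h : ∀ i j, ‖a i - a j‖ ≤ ‖b i - b j‖) :
    ∫ x, logSumExp (innerFamily a x) ∂(stdGaussian E)
      ≤ ∫ x, logSumExp (innerFamily b x) ∂(stdGaussian F) := by
  have := integral_logSumExp_le_of_increments (integral_map_innerFamily a)
    (integral_map_innerFamily b) fun i j => by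
      rw [integral_sq_sub_map_innerFamily, integral_sq_sub_map_innerFamily]
      exact pow_le_pow_left₀ (norm_nonneg _) (h i j) 2
  rwa [integral_map (by fun_prop) continuous_logSumExp.aestronglyMeasurable,
    integral_map (by fun_prop) continuous_logSumExp.aestronglyMeasurable] at this

lemma integrable_logSumExp_innerFamily [Nonempty ι] (a : ι → E) :
    Integrable (fun x => logSumExp (innerFamily a x)) (stdGaussian E) :=
  (integrable_map_measure continuous_logSumExp.aestronglyMeasurable (by fun_prop)).1
    (integrable_logSumExp ((stdGaussian E).map (innerFamily a)))

lemma integrable_norm_clm_stdGaussian {H : Type*} [NormedAddCommGroup H] [NormedSpace ℝ H]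
    (L : E →L[ℝ] H) : Integrable (fun x => ‖L x‖) (stdGaussian E) :=
  Integrable.mono' (IsGaussian.integrable_id.norm.const_mul ‖L‖)
    L.continuous.norm.aestronglyMeasurable
    (ae_of_all _ fun x => by rw [norm_norm]; exact L.le_opNorm x)

lemma integrable_norm_comp_stdGaussian {κ : Type*} [Fintype κ] (e : κ → ι) :
    Integrable (fun x => ‖WithLp.toLp 2 (fun k => x (e k))‖)
      (stdGaussian (EuclideanSpace ℝ ι)) :=
  integrable_norm_clm_stdGaussian ((EuclideanSpace.equiv κ ℝ).symm.toContinuousLinearMap.comp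
    (ContinuousLinearMap.pi fun k => EuclideanSpace.proj (e k)))

/-- The expected norm of `k` coordinates of a standard Gaussian vector is at most `√k`. -/
lemma integral_norm_comp_stdGaussian_le {κ : Type*} [Fintype κ] (e : κ → ι) :
    ∫ x, ‖WithLp.toLp 2 (fun k => x (e k))‖ ∂(stdGaussian (EuclideanSpace ℝ ι))
      ≤ √(Fintype.card κ) := by
  classical
  have hi : ∀ i : ι, Integrable (fun x : EuclideanSpace ℝ ι => x i ^ 2)
      (stdGaussian (EuclideanSpace ℝ ι)) := fun i => by
    have := (IsGaussian.memLp_dual (stdGaussian (EuclideanSpace ℝ ι))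
      (EuclideanSpace.proj i) 2 (by simp)).integrable_sq
    simpa using this
  have h1 : ∀ i : ι, ∫ x, x i ^ 2 ∂(stdGaussian (EuclideanSpace ℝ ι)) = 1 := fun i => by
    simpa [EuclideanSpace.inner_single_left] using
      integral_inner_sq_stdGaussian (EuclideanSpace.single i (1 : ℝ))
  rcases isEmpty_or_nonempty κ with hκ | hκ
  · have : ∀ x : EuclideanSpace ℝ ι, ‖WithLp.toLp 2 (fun k => x (e k))‖ = 0 := fun x => by
      simp [EuclideanSpace.norm_eq]
    simp [this]
  set s := √(Fintype.card κ) with hs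
  have hs2 : s ^ 2 = Fintype.card κ := sq_sqrt (Nat.cast_nonneg _)
  have hs0 : 0 < s := sqrt_pos.2 (by exact_mod_cast Fintype.card_pos)
  have hsum : ∫ x, ∑ k, x (e k) ^ 2 ∂(stdGaussian (EuclideanSpace ℝ ι)) = s ^ 2 := by
    rw [integral_finsetSum _ fun k _ => hi (e k)]
    simp [h1, hs2]
  have hint : Integrable (fun x : EuclideanSpace ℝ ι => ((∑ k, x (e k) ^ 2) / s + s) / 2)
      (stdGaussian (EuclideanSpace ℝ ι)) :=
    (((integrable_finsetSum _ fun k _ => hi (e k)).div_const _).add (integrable_const _)).div_const _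
  refine (integral_mono_of_nonneg (ae_of_all _ fun x => norm_nonneg _) hint
    (ae_of_all _ fun x => ?_)).trans_eq ?_
  · have h2 := EuclideanSpace.real_norm_sq_eq (WithLp.toLp 2 (fun k => x (e k)))
    simp only at h2 ⊢
    rw [← h2, le_div_iff₀ two_pos, ← sub_le_iff_le_add, le_div_iff₀ hs0]
    nlinarith [sq_nonneg (‖WithLp.toLp 2 (fun k => x (e k))‖ - s)]
  · rw [integral_div, integral_add ((integrable_finsetSum _ fun k _ => hi (e k)).div_const _)
      (integrable_const _), integral_div, hsum]
    simp
    field_simp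
    ring

end StdGaussian

section Net

open scoped RealInnerProductSpace

/-- The operator norm is controlled by a bilinear form restricted to nets of the unit spheres. -/
lemma one_sub_mul_opNorm_le {V W : Type*} [NormedAddCommGroup V] [InnerProductSpace ℝ V]
    [Nontrivial V] [NormedAddCommGroup W] [InnerProductSpace ℝ W] [Nontrivial W]
    {S : Set V} {T : Set W} {ε M : ℝ}
    (hS : ∀ u : V, ‖u‖ = 1 → ∃ u' ∈ S, ‖u - u'‖ ≤ ε)
    (hT : ∀ v : W, ‖v‖ = 1 → ∃ v' ∈ T, ‖v - v'‖ ≤ ε) (hS' : ∀ u ∈ S, ‖u‖ = 1)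
    (A : W →L[ℝ] V) (h : ∀ u ∈ S, ∀ v ∈ T, ⟪u, A v⟫ ≤ M) :
    (1 - 2 * ε) * ‖A‖ ≤ M := by
  obtain ⟨u₀, hu₀⟩ := exists_norm_eq V zero_le_one
  obtain ⟨v₀, hv₀⟩ := exists_norm_eq W zero_le_one
  have key : ∀ v : W, ‖v‖ = 1 → ‖A v‖ ≤ M + 2 * ε * ‖A‖ := by
    intro v hv
    obtain ⟨u, hu, huv⟩ : ∃ u : V, ‖u‖ = 1 ∧ ‖A v‖ = ⟪u, A v⟫ := by
      by_cases h0 : A v = 0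
      · exact ⟨u₀, hu₀, by simp [h0]⟩
      · refine ⟨‖A v‖⁻¹ • A v, norm_smul_inv_norm h0, ?_⟩
        have := norm_ne_zero_iff.2 h0
        rw [real_inner_smul_left, real_inner_self_eq_norm_sq]
        field_simp
    obtain ⟨u', hu'S, hu'⟩ := hS u hu
    obtain ⟨v', hv'T, hv'⟩ := hT v hv
    have e : ⟪u, A v⟫ = ⟪u', A v'⟫ + ⟪u - u', A v⟫ + ⟪u', A (v - v')⟫ := by
      rw [map_sub, inner_sub_left, inner_sub_right]; ring
    have h₁ : ⟪u - u', A v⟫ ≤ ε * ‖A‖ := by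
      refine (real_inner_le_norm _ _).trans ?_
      refine mul_le_mul hu' ?_ (norm_nonneg _) ((norm_nonneg _).trans hu')
      simpa [hv] using A.le_opNorm v
    have h₂ : ⟪u', A (v - v')⟫ ≤ ε * ‖A‖ := by
      refine (real_inner_le_norm _ _).trans ?_
      rw [hS' u' hu'S, one_mul]
      refine (A.le_opNorm _).trans ?_
      rw [mul_comm]
      exact mul_le_mul_of_nonneg_right hv' (norm_nonneg _)
    rw [huv, e]
    linarith [h u' hu'S v' hv'T]
  have := A.opNorm_le_of_unit_norm ((norm_nonneg _).trans (key v₀ hv₀)) key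
  linarith

lemma exists_finset_net_sphere (V : Type*) [NormedAddCommGroup V] [NormedSpace ℝ V]
    [FiniteDimensional ℝ V] {ε : ℝ} (hε : 0 < ε) :
    ∃ S : Finset V, (∀ u ∈ S, ‖u‖ = 1) ∧ ∀ u : V, ‖u‖ = 1 → ∃ u' ∈ S, ‖u - u'‖ ≤ ε := by
  have : ProperSpace V := FiniteDimensional.proper_real V
  obtain ⟨t, hts, htf, ht⟩ := (isCompact_sphere (0 : V) 1).finite_cover_balls hε
  refine ⟨htf.toFinset, fun u hu => by simpa using hts (htf.mem_toFinset.1 hu), fun u hu => ?_⟩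
  obtain ⟨u', hu', hd⟩ := Set.mem_iUnion₂.1 (ht (by simpa using hu : u ∈ Metric.sphere (0 : V) 1))
  exact ⟨u', htf.mem_toFinset.2 hu', by rw [← dist_eq_norm]; exact (Metric.mem_ball.1 hd).le⟩

end Net

section GaussianMatrix

open scoped RealInnerProductSpace

variable {p q : Type*} [Fintype p] [Fintype q]

/-- The tensor product of two vectors. -/
def tensorVec (u : EuclideanSpace ℝ p) (v : EuclideanSpace ℝ q) : EuclideanSpace ℝ (p × q) :=
  WithLp.toLp 2 fun ij => u ij.1 * v ij.2

/-- The concatenation of two vectors. -/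
def concatVec (u : EuclideanSpace ℝ p) (v : EuclideanSpace ℝ q) : EuclideanSpace ℝ (p ⊕ q) :=
  WithLp.toLp 2 (Sum.elim u v)

lemma inner_tensorVec_tensorVec (u u' : EuclideanSpace ℝ p) (v v' : EuclideanSpace ℝ q) :
    ⟪tensorVec u v, tensorVec u' v'⟫ = ⟪u, u'⟫ * ⟪v, v'⟫ := by
  simp only [PiLp.inner_apply, tensorVec, Fintype.sum_prod_type, Finset.sum_mul_sum]
  simp only [RCLike.inner_apply, conj_trivial]
  exact Finset.sum_congr rfl fun i _ => Finset.sum_congr rfl fun j _ => by ring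

lemma inner_concatVec (u : EuclideanSpace ℝ p) (v : EuclideanSpace ℝ q)
    (x : EuclideanSpace ℝ (p ⊕ q)) : ⟪concatVec u v, x⟫ =
      ⟪u, WithLp.toLp 2 fun i => x (Sum.inl i)⟫ + ⟪v, WithLp.toLp 2 fun j => x (Sum.inr j)⟫ := by
  simp [PiLp.inner_apply, concatVec, Fintype.sum_sum_type]

lemma norm_tensorVec_sub_le {u u' : EuclideanSpace ℝ p} {v v' : EuclideanSpace ℝ q}
    (hu : ‖u‖ = 1) (hu' : ‖u'‖ = 1) (hv : ‖v‖ = 1) (hv' : ‖v'‖ = 1) :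
    ‖tensorVec u v - tensorVec u' v'‖ ≤ ‖concatVec u v - concatVec u' v'‖ := by
  have hc : ∀ (a a' : EuclideanSpace ℝ p) (b b' : EuclideanSpace ℝ q),
      ⟪concatVec a b, concatVec a' b'⟫ = ⟪a, a'⟫ + ⟪b, b'⟫ := fun a a' b b' => inner_concatVec a b _
  have h₁ : ⟪u, u'⟫ ≤ 1 := by simpa [hu, hu'] using real_inner_le_norm u u'
  have h₂ : ⟪v, v'⟫ ≤ 1 := by simpa [hv, hv'] using real_inner_le_norm v v'
  refine le_of_sq_le_sq ?_ (norm_nonneg _)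
  rw [norm_sub_sq_real, norm_sub_sq_real]
  simp only [← real_inner_self_eq_norm_sq, inner_tensorVec_tensorVec, hc]
  simp only [real_inner_self_eq_norm_sq, hu, hu', hv, hv']
  nlinarith [mul_nonneg (sub_nonneg.2 h₁) (sub_nonneg.2 h₂)]

variable [DecidableEq q]

/-- The operator between Euclidean spaces whose matrix has the given entries. -/
noncomputable def matrixOperator :
    EuclideanSpace ℝ (p × q) →L[ℝ] (EuclideanSpace ℝ q →L[ℝ] EuclideanSpace ℝ p) :=
  LinearMap.toContinuousLinearMap
    { toFun := fun x => LinearMap.toContinuousLinearMap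
        (Matrix.toEuclideanLin (Matrix.of fun i j => x (i, j)))
      map_add' := fun x y => by
        rw [← map_add, ← map_add]; rfl
      map_smul' := fun c x => by
        rw [RingHom.id_apply, ← map_smul, ← map_smul]; rfl }

lemma inner_tensorVec (u : EuclideanSpace ℝ p) (v : EuclideanSpace ℝ q)
    (x : EuclideanSpace ℝ (p × q)) : ⟪tensorVec u v, x⟫ = ⟪u, matrixOperator x v⟫ := by
  have : ∀ i, matrixOperator x v i = ∑ j, x (i, j) * v j := fun i => rfl
  simp only [PiLp.inner_apply, this, tensorVec, Fintype.sum_prod_type]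
  simp only [RCLike.inner_apply, conj_trivial, Finset.sum_mul]
  exact Finset.sum_congr rfl fun i _ => Finset.sum_congr rfl fun j _ => by ring

lemma integrable_norm_matrixOperator :
    Integrable (fun x => ‖(matrixOperator x : EuclideanSpace ℝ q →L[ℝ] EuclideanSpace ℝ p)‖)
      (stdGaussian (EuclideanSpace ℝ (p × q))) :=
  integrable_norm_clm_stdGaussian _

lemma mul_integral_norm_matrixOperator_le [Nonempty p] [Nonempty q] {ε : ℝ} (hε : 0 < ε) :
    (1 - 2 * ε) * ∫ x, ‖(matrixOperator x : EuclideanSpace ℝ q →L[ℝ] EuclideanSpace ℝ p)‖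
      ∂(stdGaussian (EuclideanSpace ℝ (p × q))) ≤ √(Fintype.card p) + √(Fintype.card q) := by
  obtain ⟨S, hS, hSnet⟩ := exists_finset_net_sphere (EuclideanSpace ℝ p) hε
  obtain ⟨T, hT, hTnet⟩ := exists_finset_net_sphere (EuclideanSpace ℝ q) hε
  obtain ⟨u₀, hu₀⟩ := exists_norm_eq (EuclideanSpace ℝ p) zero_le_one
  obtain ⟨v₀, hv₀⟩ := exists_norm_eq (EuclideanSpace ℝ q) zero_le_one
  obtain ⟨u₁, hu₁, -⟩ := hSnet u₀ hu₀
  obtain ⟨v₁, hv₁, -⟩ := hTnet v₀ hv₀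
  have : Nonempty (S × T) := ⟨(⟨u₁, hu₁⟩, ⟨v₁, hv₁⟩)⟩
  set I := ∫ x, ‖(matrixOperator x : EuclideanSpace ℝ q →L[ℝ] EuclideanSpace ℝ p)‖
      ∂(stdGaussian (EuclideanSpace ℝ (p × q))) with hI
  set R := √(Fintype.card p) + √(Fintype.card q) with hR
  have bound : ∀ β : ℝ, 0 < β → (1 - 2 * ε) * I ≤ log (Fintype.card (S × T)) * β⁻¹ + R := by
    intro β hβ
    let a : S × T → EuclideanSpace ℝ (p × q) := fun i => β • tensorVec i.1.1 i.2.1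
    let b : S × T → EuclideanSpace ℝ (p ⊕ q) := fun i => β • concatVec i.1.1 i.2.1
    have hab : ∀ i j, ‖a i - a j‖ ≤ ‖b i - b j‖ := fun i j => by
      simp only [a, b, ← smul_sub, norm_smul]
      exact mul_le_mul_of_nonneg_left (norm_tensorVec_sub_le (hS _ i.1.2) (hS _ j.1.2)
        (hT _ i.2.2) (hT _ j.2.2)) (norm_nonneg _)
    have lower : β * ((1 - 2 * ε) * I) ≤
        ∫ x, logSumExp (innerFamily a x) ∂(stdGaussian (EuclideanSpace ℝ (p × q))) := by
      rw [hI, ← integral_const_mul, ← integral_const_mul]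
      refine integral_mono ((integrable_norm_matrixOperator.const_mul _).const_mul _)
        (integrable_logSumExp_innerFamily a) fun x => ?_
      have := one_sub_mul_opNorm_le (S := (S : Set (EuclideanSpace ℝ p)))
        (T := (T : Set (EuclideanSpace ℝ q))) (M := β⁻¹ * logSumExp (innerFamily a x))
        hSnet hTnet hS (matrixOperator x) fun u hu v hv => by
          have := le_logSumExp (innerFamily a x) (⟨u, hu⟩, ⟨v, hv⟩)
          rw [innerFamily_apply, real_inner_smul_left, inner_tensorVec] at this
          rwa [le_inv_mul_iff₀ hβ]
      rwa [le_inv_mul_iff₀ hβ] at this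
    have hn₁ := integrable_norm_comp_stdGaussian (Sum.inl : p → p ⊕ q)
    have hn₂ := integrable_norm_comp_stdGaussian (Sum.inr : q → p ⊕ q)
    have upper : ∫ x, logSumExp (innerFamily b x) ∂(stdGaussian (EuclideanSpace ℝ (p ⊕ q)))
        ≤ log (Fintype.card (S × T)) + β * R := by
      have hmono := integral_mono (integrable_logSumExp_innerFamily b)
        ((integrable_const (log (Fintype.card (S × T)))).add ((hn₁.add hn₂).const_mul β))
        fun x => logSumExp_le (x := innerFamily b x) fun i => by
          rw [innerFamily_apply, real_inner_smul_left, inner_concatVec]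
          refine mul_le_mul_of_nonneg_left (add_le_add ?_ ?_) hβ.le
          · simpa [hS _ i.1.2] using real_inner_le_norm i.1.1 (WithLp.toLp 2 fun k => x (Sum.inl k))
          · simpa [hT _ i.2.2] using real_inner_le_norm i.2.1 (WithLp.toLp 2 fun k => x (Sum.inr k))
      refine hmono.trans ?_
      rw [integral_add' (integrable_const _) ((hn₁.add hn₂).const_mul β), integral_const_mul,
        integral_add' hn₁ hn₂]
      have h₁ := integral_norm_comp_stdGaussian_le (Sum.inl : p → p ⊕ q)
      have h₂ := integral_norm_comp_stdGaussian_le (Sum.inr : q → p ⊕ q)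
      simpa using mul_le_mul_of_nonneg_left (add_le_add h₁ h₂) hβ.le
    have := (lower.trans (integral_logSumExp_innerFamily_le hab)).trans upper
    rw [← le_inv_mul_iff₀ hβ] at this
    refine this.trans_eq ?_
    field_simp
  have hlim := ((tendsto_inv_atTop_zero (𝕜 := ℝ)).const_mul
    (log (Fintype.card (S × T)))).add_const R
  rw [mul_zero, zero_add] at hlim
  exact ge_of_tendsto hlim ((Filter.eventually_gt_atTop 0).mono bound)

theorem integral_norm_matrixOperator_le :
    ∫ x, ‖(matrixOperator x : EuclideanSpace ℝ q →L[ℝ] EuclideanSpace ℝ p)‖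
      ∂(stdGaussian (EuclideanSpace ℝ (p × q))) ≤ √(Fintype.card p) + √(Fintype.card q) := by
  rcases isEmpty_or_nonempty p with hp | hp
  · have : ∀ x, (matrixOperator x : EuclideanSpace ℝ q →L[ℝ] EuclideanSpace ℝ p) = 0 :=
      fun x => by ext v i; exact hp.elim i
    simp [this]
  rcases isEmpty_or_nonempty q with hq | hq
  · have : ∀ x, (matrixOperator x : EuclideanSpace ℝ q →L[ℝ] EuclideanSpace ℝ p) = 0 :=
      fun x => by
        ext v i
        rw [Subsingleton.elim v 0]
        simp
    simp [this]
  set I := ∫ x, ‖(matrixOperator x : EuclideanSpace ℝ q →L[ℝ] EuclideanSpace ℝ p)‖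
      ∂(stdGaussian (EuclideanSpace ℝ (p × q))) with hI
  have hlim : Filter.Tendsto (fun ε : ℝ => (1 - 2 * ε) * I) (nhdsWithin 0 (Set.Ioi 0))
      (nhds ((1 - 2 * 0) * I)) :=
    (Continuous.tendsto (by fun_prop) 0).mono_left nhdsWithin_le_nhds
  rw [mul_zero, sub_zero, one_mul] at hlim
  exact le_of_tendsto hlim (Filter.eventually_of_mem self_mem_nhdsWithin
    fun ε hε => mul_integral_norm_matrixOperator_le hε)

end GaussianMatrix

/-- If the entries of a random matrix `G ∈ ℝ^{n₁×n₂}` are independent standard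
Gaussian, then `E‖G‖_op ≤ √n₁ + √n₂`. -/
theorem expected_opNorm_gaussian_le (n₁ n₂ : ℕ) {Ω : Type*} [MeasurableSpace Ω]
    (P : Measure Ω) [IsProbabilityMeasure P]
    (G : Ω → Matrix (Fin n₁) (Fin n₂) ℝ)
    (hG : Measure.map (fun ω => fun ij : Fin n₁ × Fin n₂ => G ω ij.1 ij.2) P
      = Measure.pi fun _ : Fin n₁ × Fin n₂ => gaussianReal 0 1) :
    ∫ ω, opNorm (G ω) ∂P ≤ Real.sqrt n₁ + Real.sqrt n₂ := by
  set Γ : Measure (Fin n₁ × Fin n₂ → ℝ) := Measure.pi fun _ => gaussianReal 0 1 with hΓ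
  have hmeas : AEMeasurable (fun ω => fun ij : Fin n₁ × Fin n₂ => G ω ij.1 ij.2) P := by
    by_contra h
    rw [Measure.map_of_not_aemeasurable h] at hG
    exact IsProbabilityMeasure.ne_zero Γ hG.symm
  have hcont : Continuous fun x : EuclideanSpace ℝ (Fin n₁ × Fin n₂) =>
      ‖(matrixOperator x : EuclideanSpace ℝ (Fin n₂) →L[ℝ] EuclideanSpace ℝ (Fin n₁))‖ := by
    fun_prop
  have h : ∫ ω, opNorm (G ω) ∂P
      = ∫ x, ‖(matrixOperator x : EuclideanSpace ℝ (Fin n₂) →L[ℝ] EuclideanSpace ℝ (Fin n₁))‖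
        ∂(stdGaussian (EuclideanSpace ℝ (Fin n₁ × Fin n₂))) := by
    rw [← map_pi_eq_stdGaussian, integral_map (by fun_prop) hcont.aestronglyMeasurable, ← hΓ, ← hG]
    exact (integral_map hmeas
      (hcont.comp (PiLp.continuous_toLp 2 _)).aestronglyMeasurable).symm
  rw [h]
  simpa using integral_norm_matrixOperator_le (p := Fin n₁) (q := Fin n₂)
end

section
/- Let G ∈ ℝ^{n₁×n₂} be a random matrix whose entries are independent standard Gaussian. Then for every t > 0, P(‖G‖_op ≥ √n₁ + √n₂ + t) ≤ exp(−t²/2), where ‖·‖_op is the operator (spectral) norm. -/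
open MeasureTheory ProbabilityTheory Real BigOperators

/-- The standard Gaussian measure on `ι → ℝ`. -/
noncomputable abbrev gaussianPi (ι : Type*) [Fintype ι] : Measure (ι → ℝ) :=
  Measure.pi fun _ : ι => gaussianReal 0 1

theorem gaussianPi_eq_withDensity (ι : Type*) [Fintype ι] :
    gaussianPi ι = (volume : Measure (ι → ℝ)).withDensity
      fun x => ENNReal.ofReal (∏ k, gaussianPDFReal 0 1 (x k)) := by
  refine Measure.pi_eq fun s hs => ?_
  have hInt : ∀ k, Integrable (gaussianPDFReal 0 1) ((volume : Measure ℝ).restrict (s k)) :=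
    fun k => (integrable_gaussianPDFReal 0 1).restrict
  rw [withDensity_apply _ (MeasurableSet.univ_pi hs), volume_pi, Measure.restrict_pi_pi,
    ← ofReal_integral_eq_lintegral_ofReal (Integrable.fintype_prod hInt)
      (ae_of_all _ fun x => Finset.prod_nonneg fun k _ => gaussianPDFReal_nonneg _ _ _),
    integral_fintype_prod_eq_prod (fun _ => gaussianPDFReal 0 1),
    ENNReal.ofReal_prod_of_nonneg fun k _ =>
      integral_nonneg fun x => gaussianPDFReal_nonneg _ _ _]
  exact Finset.prod_congr rfl fun k _ =>
    (gaussianReal_apply_eq_integral 0 one_ne_zero (s k)).symm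

theorem integrable_exp_mul_sum_abs (ι : Type*) [Fintype ι] (C : ℝ) :
    Integrable (fun z : ι → ℝ => exp (C * ∑ k, |z k|)) (gaussianPi ι) := by
  have h1 : Integrable (fun x : ℝ => exp (C * |x|)) (gaussianReal 0 1) := by
    refine ((integrable_exp_mul_gaussianReal (μ := 0) (v := 1) C).add
      (integrable_exp_mul_gaussianReal (μ := 0) (v := 1) (-C))).mono'
      (by fun_prop) (ae_of_all _ fun x => ?_)
    rw [norm_eq_abs, abs_of_pos (exp_pos _), Pi.add_apply]
    rcases abs_cases x with ⟨h, -⟩ | ⟨h, -⟩ <;> rw [h]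
    · linarith [exp_pos (-C * x)]
    · rw [mul_neg, ← neg_mul]; linarith [exp_pos (C * x)]
  refine (Integrable.fintype_prod (f := fun _ : ι => fun x : ℝ => exp (C * |x|))
    fun _ => h1).congr (ae_of_all _ fun z => ?_)
  simp only [← exp_sum, Finset.mul_sum]

theorem integrable_of_abs_le_exp {ι : Type*} [Fintype ι] {f : (ι → ℝ) → ℝ} (hf : Measurable f)
    (K C : ℝ) (h : ∀ z, |f z| ≤ K * exp (C * ∑ k, |z k|)) :
    Integrable f (gaussianPi ι) :=
  ((integrable_exp_mul_sum_abs ι C).const_mul K).mono' hf.aestronglyMeasurable (ae_of_all _ h)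

/-- Gaussian integration by parts (Stein's identity) in the direction `c`. -/
theorem integral_dotProduct_mul_gaussianPi {ι : Type*} [Fintype ι] {f f' : (ι → ℝ) → ℝ}
    (c : ι → ℝ) (hf : Integrable f (gaussianPi ι)) (hf' : Integrable f' (gaussianPi ι))
    (hcf : Integrable (fun z => (c ⬝ᵥ z) * f z) (gaussianPi ι))
    (hd : ∀ z, HasLineDerivAt ℝ f (f' z) z c) :
    ∫ z, (c ⬝ᵥ z) * f z ∂(gaussianPi ι) = ∫ z, f' z ∂(gaussianPi ι) := by
  set ρ : (ι → ℝ) → ℝ := fun x => ∏ k, gaussianPDFReal 0 1 (x k) with hρ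
  have hρ0 : ∀ x, 0 ≤ ρ x := fun x => Finset.prod_nonneg fun k _ => gaussianPDFReal_nonneg _ _ _
  have hρm : Measurable ρ := by
    refine Finset.measurable_prod _ fun k _ => ?_
    exact (measurable_gaussianPDFReal 0 1).comp (measurable_pi_apply k)
  have hρm' : Measurable fun x => ENNReal.ofReal (ρ x) := hρm.ennreal_ofReal
  have hfin : ∀ᵐ x ∂(volume : Measure (ι → ℝ)), ENNReal.ofReal (ρ x) < ⊤ :=
    ae_of_all _ fun x => ENNReal.ofReal_lt_top
  rw [gaussianPi_eq_withDensity] at hf hf' hcf ⊢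
  rw [integrable_withDensity_iff hρm' hfin] at hf hf' hcf
  rw [integral_withDensity_eq_integral_toReal_smul hρm' hfin,
    integral_withDensity_eq_integral_toReal_smul hρm' hfin]
  simp only [ENNReal.toReal_ofReal (hρ0 _)] at hf hf' hcf ⊢
  have hρd : ∀ z, HasLineDerivAt ℝ ρ (-(c ⬝ᵥ z) * ρ z) z c := by
    intro z
    have h1 : ∀ k, HasDerivAt (fun t : ℝ => gaussianPDFReal 0 1 ((z + t • c) k))
        (-(c k * z k) * gaussianPDFReal 0 1 (z k)) 0 := by
      intro k
      have hin : HasDerivAt (fun t : ℝ => (z + t • c) k) (c k) 0 := by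
        simpa using ((hasDerivAt_id (0 : ℝ)).mul_const (c k)).const_add (z k)
      have := ((((hin.sub_const 0).pow 2).neg.div_const (2 * ((1 : NNReal) : ℝ))).exp).const_mul
        ((√(2 * π * ((1 : NNReal) : ℝ)))⁻¹)
      refine this.congr_deriv ?_
      simp [gaussianPDFReal]
      ring
    classical
    have h2 := HasDerivAt.fun_finsetProd (u := Finset.univ) fun k _ => h1 k
    refine h2.congr_deriv ?_
    simp only [zero_smul, add_zero, smul_eq_mul, dotProduct, ← Finset.sum_neg_distrib,
      Finset.sum_mul, hρ]
    refine Finset.sum_congr rfl fun k _ => ?_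
    rw [← Finset.mul_prod_erase Finset.univ _ (Finset.mem_univ k)]
    ring
  have key := integral_bilinear_hasLineDerivAt_right_eq_neg_left_of_integrable
    (μ := (volume : Measure (ι → ℝ))) (B := ContinuousLinearMap.mul ℝ ℝ)
    (f := f) (f' := f') (g := ρ) (g' := fun z => -(c ⬝ᵥ z) * ρ z) (v := c)
    (by simpa using hf')
    (by
      refine hcf.neg.congr (ae_of_all _ fun z => ?_)
      simp only [Pi.neg_apply, ContinuousLinearMap.mul_apply']
      ring) (by simpa using hf) (fun z _ => hd z) fun z _ => hρd z
  simp only [ContinuousLinearMap.mul_apply', smul_eq_mul] at key ⊢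
  rw [← neg_inj, ← integral_neg]
  calc _ = ∫ z, f z * (-(c ⬝ᵥ z) * ρ z) := by congr 1; ext z; ring
    _ = _ := key
    _ = _ := by congr 2; ext z; ring

theorem abs_dotProduct_le_mul_sum_abs {ι : Type*} [Fintype ι] {v : ι → ℝ} {M : ℝ}
    (hv : ∀ k, |v k| ≤ M) (z : ι → ℝ) : |v ⬝ᵥ z| ≤ M * ∑ k, |z k| := by
  rw [dotProduct, Finset.mul_sum]
  refine (Finset.abs_sum_le_sum_abs _ _).trans (Finset.sum_le_sum fun k _ => ?_)
  rw [abs_mul]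
  exact mul_le_mul_of_nonneg_right (hv k) (abs_nonneg _)

theorem hasDerivAt_sum_exp_rpow {κ : Type*} [Fintype κ] [Nonempty κ] {V : κ → ℝ → ℝ}
    {w : κ → ℝ} {t : ℝ} (p : ℝ) (h : ∀ j, HasDerivAt (V j) (w j) t) :
    HasDerivAt (fun s => (∑ j, exp (V j s)) ^ p)
      ((∑ j, exp (V j t) * w j) * p * (∑ j, exp (V j t)) ^ (p - 1)) t :=
  (HasDerivAt.fun_sum fun j _ => (h j).exp).rpow_const
    (Or.inl (Finset.sum_pos (fun _ _ => exp_pos _) Finset.univ_nonempty).ne')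

theorem exp_mul_sum_exp_rpow_sub_one_le {κ : Type*} [Fintype κ] (x : κ → ℝ) (a : ℝ) (i : κ) :
    exp (x i) * (∑ j, exp (x j)) ^ (a - 1) ≤ (∑ j, exp (x j)) ^ a := by
  have hi : exp (x i) ≤ ∑ j, exp (x j) :=
    Finset.single_le_sum (fun j _ => (exp_pos (x j)).le) (Finset.mem_univ i)
  have hS : 0 < ∑ j, exp (x j) := (exp_pos _).trans_le hi
  rw [rpow_sub_one hS.ne', mul_div_assoc', div_le_iff₀ hS, mul_comm]
  exact mul_le_mul_of_nonneg_left hi (rpow_nonneg hS.le _)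

theorem sum_exp_rpow_le {κ : Type*} [Fintype κ] {x : κ → ℝ} {a L : ℝ} (ha : 0 ≤ a)
    (ha1 : a ≤ 1) (hL : 0 ≤ L) (hx : ∀ j, |x j| ≤ L) :
    (∑ j, exp (x j)) ^ a ≤ (Fintype.card κ + 1) * exp L := by
  have hS0 : 0 ≤ ∑ j, exp (x j) := Finset.sum_nonneg fun j _ => (exp_pos _).le
  have hS : ∑ j, exp (x j) ≤ Fintype.card κ * exp L := by
    calc _ ≤ ∑ _j : κ, exp L :=
          Finset.sum_le_sum fun j _ => exp_le_exp.2 ((le_abs_self _).trans (hx j))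
      _ = _ := by simp
  have h1 : (∑ j, exp (x j)) ^ a ≤ (1 + ∑ j, exp (x j)) ^ a :=
    rpow_le_rpow hS0 (by linarith) ha
  have h2 : (1 + ∑ j, exp (x j)) ^ a ≤ (1 + ∑ j, exp (x j)) ^ (1 : ℝ) :=
    rpow_le_rpow_of_exponent_le (by linarith) ha1
  rw [rpow_one] at h2
  have := one_le_exp hL
  linarith

theorem measurable_sum_exp_dotProduct_rpow {ι κ : Type*} [Fintype ι] [Fintype κ]
    (v : κ → ι → ℝ) (p : ℝ) :
    Measurable fun z : ι → ℝ => (∑ j, exp (v j ⬝ᵥ z)) ^ p := by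
  have h : ∀ j, Measurable fun z : ι → ℝ => v j ⬝ᵥ z := fun j => by
    unfold dotProduct; fun_prop
  fun_prop

theorem exists_forall_abs_le {ι κ : Type*} [Fintype ι] [Fintype κ] (v : κ → ι → ℝ) :
    ∃ M, 0 ≤ M ∧ ∀ j k, |v j k| ≤ M := by
  refine ⟨∑ j, ∑ k, |v j k|, by positivity, fun j k => ?_⟩
  refine (Finset.single_le_sum (f := fun k => |v j k|) (fun _ _ => abs_nonneg _)
    (Finset.mem_univ k)).trans ?_
  exact Finset.single_le_sum (f := fun j => ∑ k, |v j k|)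
    (fun _ _ => Finset.sum_nonneg fun _ _ => abs_nonneg _) (Finset.mem_univ j)

theorem integrable_sum_exp_dotProduct_rpow {ι κ : Type*} [Fintype ι] [Fintype κ]
    (v : κ → ι → ℝ) {a : ℝ} (ha : 0 ≤ a) (ha1 : a ≤ 1) :
    Integrable (fun z => (∑ j, exp (v j ⬝ᵥ z)) ^ a) (gaussianPi ι) := by
  obtain ⟨M, hM0, hM⟩ := exists_forall_abs_le v
  refine integrable_of_abs_le_exp (measurable_sum_exp_dotProduct_rpow v a)
    (Fintype.card κ + 1) M fun z => ?_
  rw [abs_of_nonneg (rpow_nonneg (Finset.sum_nonneg fun _ _ => (exp_pos _).le) _)]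
  exact sum_exp_rpow_le ha ha1 (by positivity) fun j => abs_dotProduct_le_mul_sum_abs (hM j) z

theorem abs_dotProduct_mul_exp_mul_sum_exp_rpow_le {ι κ : Type*} [Fintype ι] [Fintype κ]
    {v : κ → ι → ℝ} {c : ι → ℝ} {D M a : ℝ} (hM0 : 0 ≤ M) (ha : 0 ≤ a) (ha1 : a ≤ 1)
    (hD : ∀ k, |c k| ≤ D) (hM : ∀ j k, |v j k| ≤ M) (i : κ) (z : ι → ℝ) :
    |(c ⬝ᵥ z) * (exp (v i ⬝ᵥ z) * (∑ j, exp (v j ⬝ᵥ z)) ^ (a - 1))|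
      ≤ (Fintype.card κ + 1) * exp ((D + M) * ∑ k, |z k|) := by
  have h1 := abs_dotProduct_le_mul_sum_abs hD z
  have h2 := (exp_mul_sum_exp_rpow_sub_one_le (fun j => v j ⬝ᵥ z) a i).trans
    (sum_exp_rpow_le ha ha1 (by positivity) fun j => abs_dotProduct_le_mul_sum_abs (hM j) z)
  have h3 : D * ∑ k, |z k| ≤ exp (D * ∑ k, |z k|) := by
    linarith [add_one_le_exp (D * ∑ k, |z k|)]
  have h4 : 0 ≤ exp (v i ⬝ᵥ z) * (∑ j, exp (v j ⬝ᵥ z)) ^ (a - 1) := by positivity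
  rw [abs_mul, abs_of_nonneg h4, add_mul D, exp_add]
  calc _ ≤ exp (D * ∑ k, |z k|) * ((Fintype.card κ + 1) * exp (M * ∑ k, |z k|)) :=
        mul_le_mul (h1.trans h3) h2 h4 (exp_pos _).le
    _ = _ := by ring

theorem integrable_dotProduct_mul_exp_mul_sum_exp_rpow {ι κ : Type*} [Fintype ι] [Fintype κ]
    (v : κ → ι → ℝ) (c : ι → ℝ) (i : κ) {a : ℝ} (ha : 0 ≤ a) (ha1 : a ≤ 1) :
    Integrable (fun z => (c ⬝ᵥ z) * (exp (v i ⬝ᵥ z) * (∑ j, exp (v j ⬝ᵥ z)) ^ (a - 1)))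
      (gaussianPi ι) := by
  obtain ⟨M, hM0, hM⟩ := exists_forall_abs_le v
  obtain ⟨D, hD0, hD⟩ := exists_forall_abs_le fun _ : Unit => c
  have h : ∀ c : ι → ℝ, Measurable fun z : ι → ℝ => c ⬝ᵥ z := fun j => by
    unfold dotProduct; fun_prop
  refine integrable_of_abs_le_exp
    ((h c).mul ((h _).exp.mul (measurable_sum_exp_dotProduct_rpow v _)))
    (Fintype.card κ + 1) (D + M) fun z =>
      abs_dotProduct_mul_exp_mul_sum_exp_rpow_le hM0 ha ha1 (hD ()) hM i z

theorem integral_dotProduct_mul_exp_mul_sum_exp_rpow_nonneg {ι κ : Type*} [Fintype ι]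
    [Fintype κ] [Nonempty κ] (v : κ → ι → ℝ) (c : ι → ℝ) (i : κ) {a : ℝ} (ha : 0 ≤ a)
    (ha1 : a ≤ 1) (hi : v i ⬝ᵥ c = 0) (hj : ∀ j, v j ⬝ᵥ c ≤ 0) :
    0 ≤ ∫ z, (c ⬝ᵥ z) * (exp (v i ⬝ᵥ z) * (∑ j, exp (v j ⬝ᵥ z)) ^ (a - 1)) ∂(gaussianPi ι) := by
  obtain ⟨M, hM0, hM⟩ := exists_forall_abs_le v
  have hm : ∀ c : ι → ℝ, Measurable fun z : ι → ℝ => c ⬝ᵥ z := fun j => by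
    unfold dotProduct; fun_prop
  have hS : ∀ z : ι → ℝ, 0 < ∑ j, exp (v j ⬝ᵥ z) := fun z =>
    Finset.sum_pos (fun _ _ => exp_pos _) Finset.univ_nonempty
  set D : ℝ := ∑ j, |v j ⬝ᵥ c| with hD
  have hDj : ∀ j, |v j ⬝ᵥ c| ≤ D := fun j =>
    Finset.single_le_sum (f := fun j => |v j ⬝ᵥ c|) (fun _ _ => abs_nonneg _) (Finset.mem_univ j)
  set f' : (ι → ℝ) → ℝ := fun z => (1 - a) *
    ((∑ j, exp (v j ⬝ᵥ z) * -(v j ⬝ᵥ c)) * (∑ j, exp (v j ⬝ᵥ z)) ^ (-1 : ℝ)) *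
      (exp (v i ⬝ᵥ z) * (∑ j, exp (v j ⬝ᵥ z)) ^ (a - 1)) with hf'
  have hf'0 : ∀ z, 0 ≤ f' z := fun z =>
    mul_nonneg (mul_nonneg (by linarith) (mul_nonneg (Finset.sum_nonneg fun j _ =>
      mul_nonneg (exp_pos _).le (neg_nonneg.2 (hj j))) (rpow_nonneg (hS z).le _)))
      (mul_nonneg (exp_pos _).le (rpow_nonneg (hS z).le _))
  rw [integral_dotProduct_mul_gaussianPi (f' := f') c]
  · exact integral_nonneg hf'0
  · refine integrable_of_abs_le_exp
      ((hm _).exp.mul (measurable_sum_exp_dotProduct_rpow v _))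
      (Fintype.card κ + 1) M fun z => ?_
    rw [abs_of_nonneg (by positivity)]
    exact (exp_mul_sum_exp_rpow_sub_one_le (fun j => v j ⬝ᵥ z) a i).trans
      (sum_exp_rpow_le ha ha1 (by positivity) fun j => abs_dotProduct_le_mul_sum_abs (hM j) z)
  · refine integrable_of_abs_le_exp ?_ (D * (Fintype.card κ + 1)) M fun z => ?_
    · refine Measurable.mul (Measurable.mul measurable_const (Measurable.mul ?_
        (measurable_sum_exp_dotProduct_rpow v _)))
        ((hm _).exp.mul (measurable_sum_exp_dotProduct_rpow v _))
      exact Finset.measurable_sum _ fun j _ => (hm _).exp.mul_const _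
    · rw [abs_of_nonneg (hf'0 z), mul_assoc D]
      have h1 : (∑ j, exp (v j ⬝ᵥ z) * -(v j ⬝ᵥ c)) * (∑ j, exp (v j ⬝ᵥ z)) ^ (-1 : ℝ) ≤ D := by
        rw [rpow_neg_one, ← div_eq_mul_inv, div_le_iff₀ (hS z), Finset.mul_sum]
        refine Finset.sum_le_sum fun j _ => ?_
        rw [mul_comm]
        exact mul_le_mul_of_nonneg_right ((neg_le_abs _).trans (hDj j)) (exp_pos _).le
      have h2 := (exp_mul_sum_exp_rpow_sub_one_le (fun j => v j ⬝ᵥ z) a i).trans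
        (sum_exp_rpow_le ha ha1 (by positivity) fun j =>
          abs_dotProduct_le_mul_sum_abs (hM j) z)
      have hD0 : 0 ≤ D := Finset.sum_nonneg fun _ _ => abs_nonneg _
      have h0 : 0 ≤ (∑ j, exp (v j ⬝ᵥ z) * -(v j ⬝ᵥ c)) * (∑ j, exp (v j ⬝ᵥ z)) ^ (-1 : ℝ) :=
        mul_nonneg (Finset.sum_nonneg fun j _ =>
          mul_nonneg (exp_pos _).le (neg_nonneg.2 (hj j))) (rpow_nonneg (hS z).le _)
      have h3 : (1 - a) * ((∑ j, exp (v j ⬝ᵥ z) * -(v j ⬝ᵥ c)) *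
          (∑ j, exp (v j ⬝ᵥ z)) ^ (-1 : ℝ)) ≤ D := by nlinarith
      exact (mul_le_mul h3 h2 (by positivity) hD0)
  · exact integrable_dotProduct_mul_exp_mul_sum_exp_rpow v c i ha ha1
  · intro z
    have hlin : ∀ j, HasDerivAt (fun t : ℝ => v j ⬝ᵥ (z + t • c)) (v j ⬝ᵥ c) 0 := by
      intro j
      simp only [dotProduct_add, dotProduct_smul, smul_eq_mul]
      simpa using ((hasDerivAt_id (0 : ℝ)).mul_const (v j ⬝ᵥ c)).const_add (v j ⬝ᵥ z)
    have := (hlin i).exp.mul (hasDerivAt_sum_exp_rpow (a - 1) hlin)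
    refine this.congr_deriv ?_
    simp only [zero_smul, add_zero, hi, hf', mul_neg, Finset.sum_neg_distrib]
    rw [rpow_sub_one (hS z).ne' (a - 1), rpow_neg_one]
    ring

/-- A Slepian-type comparison inequality for the functional `x ↦ (∑ exp (x j)) ^ a`. -/
theorem integral_sum_exp_rpow_le_of_gram_le {ι κ : Type*} [Fintype ι] [Fintype κ] [Nonempty κ]
    (A B : κ → ι → ℝ) {a : ℝ} (ha : 0 ≤ a) (ha1 : a ≤ 1)
    (horth : ∀ i j, A i ⬝ᵥ B j = 0) (hdiag : ∀ i, A i ⬝ᵥ A i = B i ⬝ᵥ B i)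
    (hle : ∀ i j, B i ⬝ᵥ B j ≤ A i ⬝ᵥ A j) :
    ∫ z, (∑ j, exp (A j ⬝ᵥ z)) ^ a ∂(gaussianPi ι)
      ≤ ∫ z, (∑ j, exp (B j ⬝ᵥ z)) ^ a ∂(gaussianPi ι) := by
  set v : ℝ → κ → ι → ℝ := fun θ j => cos θ • A j + sin θ • B j with hv
  set w : ℝ → κ → ι → ℝ := fun θ j => (-sin θ) • A j + cos θ • B j with hw
  set F : ℝ → (ι → ℝ) → ℝ := fun θ z => (∑ j, exp (v θ j ⬝ᵥ z)) ^ a with hF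
  set F' : ℝ → (ι → ℝ) → ℝ := fun θ z =>
    (∑ j, exp (v θ j ⬝ᵥ z) * (w θ j ⬝ᵥ z)) * a * (∑ j, exp (v θ j ⬝ᵥ z)) ^ (a - 1) with hF'
  have hF'sum : ∀ θ z, F' θ z = a * ∑ i, (w θ i ⬝ᵥ z) *
      (exp (v θ i ⬝ᵥ z) * (∑ j, exp (v θ j ⬝ᵥ z)) ^ (a - 1)) := by
    intro θ z
    simp only [hF', Finset.mul_sum, Finset.sum_mul]
    exact Finset.sum_congr rfl fun _ _ => by ring
  obtain ⟨M₁, hM₁0, hM₁⟩ := exists_forall_abs_le A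
  obtain ⟨M₂, hM₂0, hM₂⟩ := exists_forall_abs_le B
  set M := M₁ + M₂
  have hcomb : ∀ (s t : ℝ) (j : κ), |s| ≤ 1 → |t| ≤ 1 → ∀ k, |(s • A j + t • B j) k| ≤ M := by
    intro s t j hs ht k
    simp only [Pi.add_apply, Pi.smul_apply, smul_eq_mul]
    refine (abs_add_le _ _).trans ?_
    rw [abs_mul, abs_mul]
    have h1 := mul_le_mul hs (hM₁ j k) (abs_nonneg _) zero_le_one
    have h2 := mul_le_mul ht (hM₂ j k) (abs_nonneg _) zero_le_one
    simp only [M]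
    linarith
  have hvM : ∀ θ j k, |v θ j k| ≤ M := fun θ j =>
    hcomb _ _ j (abs_cos_le_one θ) (abs_sin_le_one θ)
  have hwM : ∀ θ j k, |w θ j k| ≤ M := fun θ j =>
    hcomb _ _ j (by rw [abs_neg]; exact abs_sin_le_one θ) (abs_cos_le_one θ)
  have hM0 : 0 ≤ M := add_nonneg hM₁0 hM₂0
  have hbound : ∀ θ z, ‖F' θ z‖ ≤
      (a * Fintype.card κ * (Fintype.card κ + 1)) * exp ((M + M) * ∑ k, |z k|) := by
    intro θ z
    rw [hF'sum, norm_eq_abs, abs_mul, abs_of_nonneg ha, mul_assoc a, mul_assoc a]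
    refine mul_le_mul_of_nonneg_left ((Finset.abs_sum_le_sum_abs _ _).trans ?_) ha
    rw [mul_assoc, ← nsmul_eq_mul]
    exact Finset.sum_le_card_nsmul _ _ _ fun i _ =>
      abs_dotProduct_mul_exp_mul_sum_exp_rpow_le hM0 ha ha1 (hwM θ i) (hvM θ) i z
  have hF'int : ∀ θ, Integrable (F' θ) (gaussianPi ι) := fun θ => by
    simp only [funext (hF'sum θ)]
    exact (integrable_finsetSum _ fun i _ =>
      integrable_dotProduct_mul_exp_mul_sum_exp_rpow (v θ) (w θ i) i ha ha1).const_mul a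
  have hderiv : ∀ θ, HasDerivAt (fun θ => ∫ z, F θ z ∂(gaussianPi ι))
      (∫ z, F' θ z ∂(gaussianPi ι)) θ := by
    intro θ
    refine (hasDerivAt_integral_of_dominated_loc_of_deriv_le (s := Set.univ) (F' := F')
      Filter.univ_mem
      (Filter.Eventually.of_forall fun θ =>
        (measurable_sum_exp_dotProduct_rpow (v θ) a).aestronglyMeasurable)
      (integrable_sum_exp_dotProduct_rpow (v θ) ha ha1)
      (hF'int θ).aestronglyMeasurable
      (ae_of_all _ fun z θ _ => hbound θ z)
      ((integrable_exp_mul_sum_abs ι (M + M)).const_mul _)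
      (ae_of_all _ fun z θ _ => ?_)).2
    refine hasDerivAt_sum_exp_rpow a fun j => ?_
    simp only [hv, hw, add_dotProduct, smul_dotProduct, smul_eq_mul]
    exact ((hasDerivAt_cos θ).mul_const _).add ((hasDerivAt_sin θ).mul_const _)
  have hdot : ∀ θ i j, v θ j ⬝ᵥ w θ i = cos θ * sin θ * (B j ⬝ᵥ B i - A j ⬝ᵥ A i) := by
    intro θ i j
    have : B j ⬝ᵥ A i = 0 := by rw [dotProduct_comm]; exact horth i j
    simp only [hv, hw, add_dotProduct, smul_dotProduct, smul_eq_mul, dotProduct_add,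
      dotProduct_smul, horth, this]
    ring
  have hmono : MonotoneOn (fun θ => ∫ z, F θ z ∂(gaussianPi ι)) (Set.Icc 0 (π / 2)) := by
    refine monotoneOn_of_deriv_nonneg (convex_Icc _ _)
      (fun θ _ => (hderiv θ).continuousAt.continuousWithinAt)
      (fun θ _ => (hderiv θ).differentiableAt.differentiableWithinAt) fun θ hθ => ?_
    rw [interior_Icc] at hθ
    rw [(hderiv θ).deriv]
    simp only [hF'sum]
    rw [integral_const_mul, integral_finsetSum _ fun i _ =>
      integrable_dotProduct_mul_exp_mul_sum_exp_rpow (v θ) (w θ i) i ha ha1]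
    refine mul_nonneg ha (Finset.sum_nonneg fun i _ =>
      integral_dotProduct_mul_exp_mul_sum_exp_rpow_nonneg (v θ) (w θ i) i ha ha1 ?_ fun j => ?_)
    · rw [hdot, hdiag, sub_self, mul_zero]
    · rw [hdot]
      refine mul_nonpos_of_nonneg_of_nonpos (mul_nonneg ?_ ?_) (sub_nonpos.2 (hle j i))
      · exact cos_nonneg_of_mem_Icc ⟨by linarith [pi_pos, hθ.1], hθ.2.le⟩
      · exact sin_nonneg_of_nonneg_of_le_pi hθ.1.le (by linarith [pi_pos, hθ.2])
  have := hmono (Set.left_mem_Icc.2 (by positivity)) (Set.right_mem_Icc.2 (by positivity))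
    (by positivity)
  simpa [hF, hv] using this

theorem integral_gaussianPi_sum_mul {I J : Type*} [Fintype I] [Fintype J]
    (f : (I → ℝ) → ℝ) (g : (J → ℝ) → ℝ) :
    ∫ z, f (fun i => z (Sum.inl i)) * g (fun j => z (Sum.inr j)) ∂(gaussianPi (I ⊕ J))
      = (∫ x, f x ∂(gaussianPi I)) * ∫ y, g y ∂(gaussianPi J) := by
  rw [← integral_prod_mul]
  exact (measurePreserving_sumPiEquivProdPi
    (fun _ : I ⊕ J => gaussianReal 0 1)).integral_comp' fun p => f p.1 * g p.2

theorem gaussianPDFReal_mul_exp_mul_sq (b x : ℝ) :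
    gaussianPDFReal 0 1 x * exp (b * x ^ 2) = (√(2 * π))⁻¹ * exp (-(1 / 2 - b) * x ^ 2) := by
  rw [gaussianPDFReal, mul_assoc, ← exp_add]
  simp only [NNReal.coe_one, mul_one, sub_zero]
  congr 2
  ring

theorem integrable_exp_mul_sq_gaussianReal {b : ℝ} (hb : b < 1 / 2) :
    Integrable (fun x : ℝ => exp (b * x ^ 2)) (gaussianReal 0 1) := by
  rw [gaussianReal_of_var_ne_zero _ one_ne_zero, integrable_withDensity_iff
    (measurable_gaussianPDF 0 1) (ae_of_all _ fun _ => gaussianPDF_lt_top)]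
  simp only [toReal_gaussianPDF, mul_comm _ (gaussianPDFReal _ _ _),
    gaussianPDFReal_mul_exp_mul_sq]
  exact (integrable_exp_neg_mul_sq (sub_pos.2 hb)).const_mul _

theorem integral_exp_mul_sq_gaussianReal (b : ℝ) :
    ∫ x, exp (b * x ^ 2) ∂(gaussianReal 0 1) = √((1 - 2 * b)⁻¹) := by
  rw [integral_gaussianReal_eq_integral_smul one_ne_zero]
  simp only [smul_eq_mul, gaussianPDFReal_mul_exp_mul_sq]
  rw [integral_const_mul, integral_gaussian, ← sqrt_inv, ← sqrt_mul (by positivity)]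
  congr 1
  rw [show (1 : ℝ) / 2 - b = (1 - 2 * b) / 2 by ring]
  field_simp

theorem exp_mul_integral_exp_mul_sq_pow_le (m : ℕ) {l : ℝ} (hl : 0 < l) :
    exp (l * (√m + l) / 2) *
        (∫ x, exp (l / (2 * (√m + l)) * x ^ 2) ∂(gaussianReal 0 1)) ^ m
      ≤ exp (l * √m + l ^ 2 / 2) := by
  rcases Nat.eq_zero_or_pos m with rfl | hm
  · simp [sq]
  have hs : 0 < √(m : ℝ) := sqrt_pos.2 (by exact_mod_cast hm)
  have h1 : √((1 - 2 * (l / (2 * (√m + l))))⁻¹) ≤ exp (l / (2 * √m)) := by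
    have : (1 - 2 * (l / (2 * (√m + l))))⁻¹ = l / √m + 1 := by
      have : (1 - 2 * (l / (2 * (√m + l)))) = √m / (√m + l) := by field_simp; ring
      rw [this, inv_div]
      field_simp
      ring
    rw [this, sqrt_le_left (exp_pos _).le, ← exp_nat_mul]
    refine (add_one_le_exp _).trans_eq ?_
    congr 1
    push_cast
    field_simp
  rw [integral_exp_mul_sq_gaussianReal]
  calc _ ≤ exp (l * (√m + l) / 2) * exp (l / (2 * √m)) ^ m := by gcongr
    _ = _ := by
      rw [← exp_nat_mul, ← exp_add]
      congr 1
      have : (m : ℝ) = √m * √m := (mul_self_sqrt (Nat.cast_nonneg m)).symm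
      have h2 : (m : ℝ) * (l / (2 * √m)) = √m * l / 2 := by
        nth_rw 1 [this]
        field_simp
      rw [h2]
      ring

theorem dotProduct_le_one_of_unit {ι : Type*} [Fintype ι] {x y : ι → ℝ} (hx : x ⬝ᵥ x = 1)
    (hy : y ⬝ᵥ y = 1) : x ⬝ᵥ y ≤ 1 := by
  have h : 0 ≤ (x - y) ⬝ᵥ (x - y) := Finset.sum_nonneg fun k _ => mul_self_nonneg _
  simp only [sub_dotProduct, dotProduct_sub, hx, hy, dotProduct_comm y x] at h
  linarith

/-- A unit vector satisfies `⟨x, z⟩ ≤ |z|`, with `|z|` bounded by `(|z|² / c + c) / 2`. -/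
theorem dotProduct_le_of_unit {ι : Type*} [Fintype ι] {x : ι → ℝ} (hx : x ⬝ᵥ x = 1)
    {c : ℝ} (hc : 0 < c) (z : ι → ℝ) : x ⬝ᵥ z ≤ ((∑ k, z k ^ 2) / c + c) / 2 := by
  have h : 0 ≤ (c • x - z) ⬝ᵥ (c • x - z) := Finset.sum_nonneg fun k _ => mul_self_nonneg _
  have hz : z ⬝ᵥ z = ∑ k, z k ^ 2 := Finset.sum_congr rfl fun k _ => (sq _).symm
  simp only [sub_dotProduct, dotProduct_sub, smul_dotProduct, dotProduct_smul, smul_eq_mul, hx,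
    dotProduct_comm z x, hz] at h
  rw [le_div_iff₀ two_pos, ← sub_le_iff_le_add, le_div_iff₀ hc]
  linarith

theorem sum_elim_dotProduct {I J : Type*} [Fintype I] [Fintype J] (f : I → ℝ) (g : J → ℝ)
    (z : I ⊕ J → ℝ) :
    Sum.elim f g ⬝ᵥ z = f ⬝ᵥ (fun i => z (Sum.inl i)) + g ⬝ᵥ (fun j => z (Sum.inr j)) := by
  simp [dotProduct, Fintype.sum_sum_type]

theorem integral_exp_mul_gaussianPi_unit (l : ℝ) :
    ∫ y : Unit → ℝ, exp (l * y ()) ∂(gaussianPi Unit) = exp (l ^ 2 / 2) := by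
  have h1 := integral_fintype_prod_eq_prod (ι := Unit) (μ := fun _ => gaussianReal 0 1)
    fun _ x => exp (l * x)
  simp only [Finset.univ_unique, Finset.prod_singleton] at h1
  have h2 := congrFun (mgf_id_gaussianReal (μ := 0) (v := 1)) l
  simp only [mgf, id] at h2
  rw [h2] at h1
  simpa using h1

theorem integral_sum_exp_add_const_rpow {I J κ : Type*} [Fintype I] [Fintype J] [Fintype κ]
    (W : κ → I → ℝ) {l b : ℝ} (hb : 0 < b) :
    ∫ z, (∑ j, exp (Sum.elim (Sum.elim (b • W j) (b • (1 : Unit → ℝ))) (0 : J → ℝ) ⬝ᵥ z)) ^ (l / b)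
        ∂(gaussianPi ((I ⊕ Unit) ⊕ J))
      = exp (l ^ 2 / 2) * ∫ g, (∑ j, exp (b * (W j ⬝ᵥ g))) ^ (l / b) ∂(gaussianPi I) := by
  have h1 : ∀ z : (I ⊕ Unit) ⊕ J → ℝ,
      (∑ j, exp (Sum.elim (Sum.elim (b • W j) (b • (1 : Unit → ℝ))) (0 : J → ℝ) ⬝ᵥ z)) ^ (l / b) =
      ((∑ j, exp (b * (W j ⬝ᵥ fun p => z (Sum.inl (Sum.inl p))))) ^ (l / b) *
        exp (l * z (Sum.inl (Sum.inr ())))) * 1 := by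
    intro z
    have : ∑ j, exp (Sum.elim (Sum.elim (b • W j) (b • (1 : Unit → ℝ))) (0 : J → ℝ) ⬝ᵥ z) =
        (∑ j, exp (b * (W j ⬝ᵥ fun p => z (Sum.inl (Sum.inl p))))) *
          exp (b * z (Sum.inl (Sum.inr ()))) := by
      rw [Finset.sum_mul]
      refine Finset.sum_congr rfl fun j _ => ?_
      rw [← exp_add]
      congr 1
      simp only [sum_elim_dotProduct, zero_dotProduct, smul_dotProduct, smul_eq_mul]
      simp [dotProduct]
    rw [this, mul_rpow (by positivity) (exp_pos _).le, ← exp_mul, mul_one]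
    congr 2
    field_simp
  simp only [h1]
  rw [integral_gaussianPi_sum_mul (fun x : I ⊕ Unit → ℝ =>
    (∑ j, exp (b * (W j ⬝ᵥ fun p => x (Sum.inl p)))) ^ (l / b) * exp (l * x (Sum.inr ())))
    (fun _ => 1), integral_gaussianPi_sum_mul (fun x : I → ℝ =>
    (∑ j, exp (b * (W j ⬝ᵥ x))) ^ (l / b)) (fun y : Unit → ℝ => exp (l * y ())),
    integral_exp_mul_gaussianPi_unit]
  simp [mul_comm]

theorem div_two_mul_sqrt_card_add_lt_half {ε : Type*} [Fintype ε] [Nonempty ε] {l : ℝ}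
    (hl : 0 < l) : l / (2 * (√(Fintype.card ε : ℝ) + l)) < 1 / 2 := by
  have : 0 < √(Fintype.card ε : ℝ) := sqrt_pos.2 (by exact_mod_cast Fintype.card_pos)
  rw [div_lt_div_iff₀ (by positivity) two_pos]
  linarith

theorem integral_sum_exp_rpow_le_of_unit {I α δ κ : Type*} [Fintype I] [Fintype α] [Fintype δ]
    [Fintype κ] (u : κ → α → ℝ) (v : κ → δ → ℝ) (hu : ∀ j, u j ⬝ᵥ u j = 1)
    (hv : ∀ j, v j ⬝ᵥ v j = 1) {l b : ℝ} (hl : 0 < l) (hb : l ≤ b) :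
    ∫ z, (∑ j, exp (Sum.elim (0 : I → ℝ) (Sum.elim (b • u j) (b • v j)) ⬝ᵥ z)) ^ (l / b)
        ∂(gaussianPi (I ⊕ (α ⊕ δ)))
      ≤ (Fintype.card κ : ℝ) ^ (l / b) *
        exp (l * (√(Fintype.card α) + √(Fintype.card δ)) + l ^ 2) := by
  have hb0 : 0 < b := hl.trans_le hb
  have ha0 : 0 ≤ l / b := by positivity
  have ha1 : l / b ≤ 1 := (div_le_one hb0).2 hb
  set c₁ := √(Fintype.card α : ℝ) + l with hc₁
  set c₂ := √(Fintype.card δ : ℝ) + l with hc₂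
  have hc₁0 : 0 < c₁ := by positivity
  have hc₂0 : 0 < c₂ := by positivity
  set f : I ⊕ (α ⊕ δ) → ℝ → ℝ := Sum.elim (fun _ _ => 1)
    (Sum.elim (fun _ x => exp (l / (2 * c₁) * x ^ 2)) (fun _ x => exp (l / (2 * c₂) * x ^ 2)))
    with hf
  have hfint : ∀ k, Integrable (f k) (gaussianReal 0 1) := by
    rintro (k | k | k)
    · exact integrable_const 1
    · have : Nonempty α := ⟨k⟩
      exact integrable_exp_mul_sq_gaussianReal (div_two_mul_sqrt_card_add_lt_half hl)
    · have : Nonempty δ := ⟨k⟩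
      exact integrable_exp_mul_sq_gaussianReal (div_two_mul_sqrt_card_add_lt_half hl)
  have hbound : ∀ z : I ⊕ (α ⊕ δ) → ℝ,
      (∑ j, exp (Sum.elim (0 : I → ℝ) (Sum.elim (b • u j) (b • v j)) ⬝ᵥ z)) ^ (l / b) ≤
      ((Fintype.card κ : ℝ) ^ (l / b) * exp (l * c₁ / 2 + l * c₂ / 2)) * ∏ k, f k (z k) := by
    intro z
    set q := ((∑ k, z (Sum.inr (Sum.inl k)) ^ 2) / c₁ + c₁) / 2 +
      ((∑ k, z (Sum.inr (Sum.inr k)) ^ 2) / c₂ + c₂) / 2 with hq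
    have h1 : ∀ j, exp (Sum.elim (0 : I → ℝ) (Sum.elim (b • u j) (b • v j)) ⬝ᵥ z) ≤
        exp (b * q) := by
      intro j
      refine exp_le_exp.2 ?_
      simp only [sum_elim_dotProduct, zero_dotProduct, smul_dotProduct, smul_eq_mul, zero_add,
        ← mul_add]
      exact mul_le_mul_of_nonneg_left (add_le_add (dotProduct_le_of_unit (hu j) hc₁0 _)
        (dotProduct_le_of_unit (hv j) hc₂0 _)) hb0.le
    have h2 : ∑ j, exp (Sum.elim (0 : I → ℝ) (Sum.elim (b • u j) (b • v j)) ⬝ᵥ z) ≤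
        Fintype.card κ * exp (b * q) := by
      calc _ ≤ ∑ _j : κ, exp (b * q) := Finset.sum_le_sum fun j _ => h1 j
        _ = _ := by simp
    refine (rpow_le_rpow (by positivity) h2 ha0).trans_eq ?_
    rw [mul_rpow (by positivity) (exp_pos _).le, ← exp_mul, mul_assoc ((Fintype.card κ : ℝ) ^ (l / b))]
    congr 1
    simp only [hf, Fintype.prod_sum_type, Sum.elim_inl, Sum.elim_inr, Finset.prod_const_one,
      one_mul, ← exp_sum, ← exp_add, ← Finset.mul_sum]
    congr 1
    rw [hq]
    field_simp
    ring
  refine (integral_mono (integrable_sum_exp_dotProduct_rpow _ ha0 ha1)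
    ((Integrable.fintype_prod hfint).const_mul _) hbound).trans ?_
  rw [integral_const_mul, integral_fintype_prod_eq_prod]
  simp only [hf, Fintype.prod_sum_type, Sum.elim_inl, Sum.elim_inr, Finset.prod_const,
    integral_const, probReal_univ, smul_eq_mul, mul_one, one_pow, one_mul, Finset.card_univ]
  rw [mul_assoc]
  refine mul_le_mul_of_nonneg_left ?_ (by positivity)
  have h1 := exp_mul_integral_exp_mul_sq_pow_le (Fintype.card α) hl
  have h2 := exp_mul_integral_exp_mul_sq_pow_le (Fintype.card δ) hl
  rw [← hc₁] at h1
  rw [← hc₂] at h2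
  have h3 := mul_le_mul h1 h2 (by positivity) (exp_pos _).le
  rw [← exp_add] at h3
  rw [exp_add (l * c₁ / 2)]
  calc _ = _ := by ring
    _ ≤ _ := h3
    _ = _ := by congr 1; ring

theorem exp_mul_integral_sum_exp_rpow_le {α δ κ : Type*} [Fintype α] [Fintype δ] [Fintype κ]
    [Nonempty κ] (u : κ → α → ℝ) (v : κ → δ → ℝ) (hu : ∀ j, u j ⬝ᵥ u j = 1)
    (hv : ∀ j, v j ⬝ᵥ v j = 1) {l b : ℝ} (hl : 0 < l) (hb : l ≤ b) :
    exp (l ^ 2 / 2) * ∫ g, (∑ j, exp (b * ((fun p : α × δ => u j p.1 * v j p.2) ⬝ᵥ g))) ^ (l / b)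
        ∂(gaussianPi (α × δ))
      ≤ (Fintype.card κ : ℝ) ^ (l / b) *
        exp (l * (√(Fintype.card α) + √(Fintype.card δ)) + l ^ 2) := by
  have hb0 : 0 < b := hl.trans_le hb
  set W : κ → α × δ → ℝ := fun j p => u j p.1 * v j p.2 with hW
  have hWW : ∀ i j, W i ⬝ᵥ W j = (u i ⬝ᵥ u j) * (v i ⬝ᵥ v j) := by
    intro i j
    simp only [hW, dotProduct, Finset.sum_mul_sum, Fintype.sum_prod_type]
    exact Finset.sum_congr rfl fun _ _ => Finset.sum_congr rfl fun _ _ => by ring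
  set A : κ → ((α × δ) ⊕ Unit) ⊕ (α ⊕ δ) → ℝ :=
    fun j => Sum.elim (Sum.elim (b • W j) (b • 1)) 0 with hA
  set B : κ → ((α × δ) ⊕ Unit) ⊕ (α ⊕ δ) → ℝ :=
    fun j => Sum.elim 0 (Sum.elim (b • u j) (b • v j)) with hB
  have hAA : ∀ i j, A i ⬝ᵥ A j = b ^ 2 * ((u i ⬝ᵥ u j) * (v i ⬝ᵥ v j) + 1) := by
    intro i j
    simp only [hA, sum_elim_dotProduct, Sum.elim_inl, Sum.elim_inr, zero_dotProduct,
      smul_dotProduct]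
    have := hWW i j
    have h2 : (fun p => (b • W j) p) = b • W j := rfl
    simp only [h2, dotProduct_smul, this, smul_eq_mul]
    simp [dotProduct]
    ring
  have hBB : ∀ i j, B i ⬝ᵥ B j = b ^ 2 * (u i ⬝ᵥ u j + v i ⬝ᵥ v j) := by
    intro i j
    simp only [hB, sum_elim_dotProduct, Sum.elim_inl, Sum.elim_inr, zero_dotProduct,
      smul_dotProduct]
    have h2 : (fun p => (b • u j) p) = b • u j := rfl
    have h3 : (fun p => (b • v j) p) = b • v j := rfl
    simp only [h2, h3, dotProduct_smul, smul_eq_mul]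
    ring
  have hAB : ∀ i j, A i ⬝ᵥ B j = 0 := by
    intro i j
    simp [hA, hB, dotProduct, Fintype.sum_sum_type]
  have ha0 : 0 ≤ l / b := by positivity
  have ha1 : l / b ≤ 1 := (div_le_one hb0).2 hb
  have hcomp := integral_sum_exp_rpow_le_of_gram_le A B ha0 ha1 hAB
    (fun i => by rw [hAA, hBB, hu, hv]; ring) fun i j => by
      rw [hAA, hBB]
      refine mul_le_mul_of_nonneg_left ?_ (sq_nonneg b)
      nlinarith [dotProduct_le_one_of_unit (hu i) (hu j), dotProduct_le_one_of_unit (hv i) (hv j)]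
  rw [← integral_sum_exp_add_const_rpow (J := α ⊕ δ) W hb0]
  exact hcomp.trans (integral_sum_exp_rpow_le_of_unit u v hu hv hl hb)

theorem gaussianPi_exists_le_dotProduct_le {α δ κ : Type*} [Fintype α] [Fintype δ] [Fintype κ]
    [Nonempty κ] (u : κ → α → ℝ) (v : κ → δ → ℝ) (hu : ∀ j, u j ⬝ᵥ u j = 1)
    (hv : ∀ j, v j ⬝ᵥ v j = 1) {l : ℝ} (hl : 0 < l) (s : ℝ) :
    (gaussianPi (α × δ)).real {g | ∃ j, s ≤ (fun p : α × δ => u j p.1 * v j p.2) ⬝ᵥ g}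
      ≤ exp (l * (√(Fintype.card α) + √(Fintype.card δ)) + l ^ 2 / 2 - l * s) := by
  set W : κ → α × δ → ℝ := fun j p => u j p.1 * v j p.2 with hW
  set m := √(Fintype.card α : ℝ) + √(Fintype.card δ : ℝ) with hm
  have hN : (0 : ℝ) < Fintype.card κ := by exact_mod_cast Fintype.card_pos
  have key : ∀ b, l ≤ b → (gaussianPi (α × δ)).real {g | ∃ j, s ≤ W j ⬝ᵥ g} ≤
      (Fintype.card κ : ℝ) ^ (l / b) * exp (l * m + l ^ 2 / 2 - l * s) := by
    intro b hb
    have hb0 : 0 < b := hl.trans_le hb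
    have hle := exp_mul_integral_sum_exp_rpow_le u v hu hv hl hb
    have hInt : Integrable (fun g => (∑ j, exp (b * (W j ⬝ᵥ g))) ^ (l / b))
        (gaussianPi (α × δ)) := by
      simpa only [smul_dotProduct, smul_eq_mul] using
        integrable_sum_exp_dotProduct_rpow (fun j => b • W j) (a := l / b) (by positivity)
          ((div_le_one hb0).2 hb)
    have hmarkov := mul_meas_ge_le_integral_of_nonneg
      (ae_of_all _ fun g => rpow_nonneg (Finset.sum_nonneg fun _ _ => (exp_pos _).le) _)
      hInt (exp (l * s))
    have hsub : {g | ∃ j, s ≤ W j ⬝ᵥ g} ⊆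
        {g | exp (l * s) ≤ (∑ j, exp (b * (W j ⬝ᵥ g))) ^ (l / b)} := by
      rintro g ⟨j, hj⟩
      have h1 : exp (b * s) ≤ ∑ j, exp (b * (W j ⬝ᵥ g)) :=
        (exp_le_exp.2 (mul_le_mul_of_nonneg_left hj hb0.le)).trans
          (Finset.single_le_sum (f := fun j => exp (b * (W j ⬝ᵥ g)))
            (fun _ _ => (exp_pos _).le) (Finset.mem_univ j))
      refine Eq.trans_le ?_ (rpow_le_rpow (exp_pos _).le h1 (by positivity))
      rw [← exp_mul]
      congr 1
      field_simp
    have h2 := mul_le_mul_of_nonneg_left (measureReal_mono (μ := gaussianPi (α × δ)) hsub)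
      (exp_pos (l * s)).le
    have h3 := mul_le_mul_of_nonneg_left (h2.trans hmarkov) (exp_pos (l ^ 2 / 2)).le
    have h4 := h3.trans hle
    rw [← mul_assoc, ← exp_add] at h4
    rw [show l * m + l ^ 2 / 2 - l * s = (l * m + l ^ 2) - (l ^ 2 / 2 + l * s) by ring, exp_sub,
      mul_div_assoc', le_div_iff₀ (exp_pos _), mul_comm]
    exact h4
  have hlim : Filter.Tendsto
      (fun b : ℝ => (Fintype.card κ : ℝ) ^ (l / b) * exp (l * m + l ^ 2 / 2 - l * s))
      Filter.atTop (nhds (1 * exp (l * m + l ^ 2 / 2 - l * s))) := by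
    refine Filter.Tendsto.mul_const _ ?_
    have h := (continuous_const_rpow (a := (Fintype.card κ : ℝ)) hN.ne').tendsto 0
    rw [rpow_zero] at h
    exact h.comp (Filter.Tendsto.div_atTop tendsto_const_nhds Filter.tendsto_id)
  rw [one_mul] at hlim
  exact ge_of_tendsto hlim (Filter.eventually_atTop.2 ⟨l, key⟩)

theorem gaussianPi_exists_nat_lt_dotProduct_le {α δ : Type*} [Fintype α] [Fintype δ]
    (u : ℕ → α → ℝ) (v : ℕ → δ → ℝ) (hu : ∀ j, u j ⬝ᵥ u j = 1)
    (hv : ∀ j, v j ⬝ᵥ v j = 1) {t : ℝ} (ht : 0 < t) :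
    gaussianPi (α × δ) {g | ∃ j, √(Fintype.card α) + √(Fintype.card δ) + t <
        (fun p : α × δ => u j p.1 * v j p.2) ⬝ᵥ g}
      ≤ ENNReal.ofReal (exp (-t ^ 2 / 2)) := by
  set s := √(Fintype.card α : ℝ) + √(Fintype.card δ : ℝ) + t with hs
  set E : ℕ → Set (α × δ → ℝ) := fun N =>
    {g | ∃ j : Fin (N + 1), s ≤ (fun p : α × δ => u j p.1 * v j p.2) ⬝ᵥ g} with hE
  have hmono : Monotone E := by
    rintro N N' h g ⟨j, hj⟩
    exact ⟨⟨j, by omega⟩, hj⟩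
  calc _ ≤ gaussianPi (α × δ) (⋃ N, E N) := by
        refine measure_mono ?_
        rintro g ⟨j, hj⟩
        exact Set.mem_iUnion.2 ⟨j, ⟨j, by omega⟩, hj.le⟩
    _ = ⨆ N, gaussianPi (α × δ) (E N) := hmono.measure_iUnion
    _ ≤ _ := by
        refine iSup_le fun N => ?_
        have h := gaussianPi_exists_le_dotProduct_le (κ := Fin (N + 1)) (fun j => u j)
          (fun j => v j) (fun j => hu j) (fun j => hv j) ht s
        rw [← ofReal_measureReal]
        refine ENNReal.ofReal_le_ofReal (h.trans_eq ?_)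
        congr 1
        rw [hs]
        ring

theorem exists_unit_lt_inner_of_lt_opNorm {p q : Type*} [Fintype p] [Fintype q] [DecidableEq q]
    {A : Matrix p q ℝ} {s : ℝ} (hs : 0 ≤ s) (h : s < opNorm A) :
    ∃ x : Metric.sphere (0 : EuclideanSpace ℝ p) 1 × Metric.sphere (0 : EuclideanSpace ℝ q) 1,
      s < inner ℝ (x.1 : EuclideanSpace ℝ p) (Matrix.toEuclideanLin A x.2) := by
  have : ∃ x, s * ‖x‖ < ‖Matrix.toEuclideanLin A x‖ := by
    by_contra! hc
    exact h.not_ge (ContinuousLinearMap.opNorm_le_bound _ hs hc)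
  obtain ⟨x, hx⟩ := this
  have hy0 : 0 < ‖Matrix.toEuclideanLin A x‖ := (by positivity : 0 ≤ s * ‖x‖).trans_lt hx
  have hx0 : 0 < ‖x‖ := by
    rw [norm_pos_iff]
    rintro rfl
    simp at hy0
  refine ⟨(⟨‖Matrix.toEuclideanLin A x‖⁻¹ • Matrix.toEuclideanLin A x, ?_⟩,
    ⟨‖x‖⁻¹ • x, ?_⟩), ?_⟩
  · rw [mem_sphere_zero_iff_norm, norm_smul, norm_inv, norm_norm, inv_mul_cancel₀ hy0.ne']
  · rw [mem_sphere_zero_iff_norm, norm_smul, norm_inv, norm_norm, inv_mul_cancel₀ hx0.ne']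
  · simp only [map_smul, inner_smul_left, inner_smul_right, real_inner_self_eq_norm_sq]
    rw [← lt_div_iff₀ hx0] at hx
    refine hx.trans_eq ?_
    simp
    field_simp

theorem inner_toEuclideanLin_eq_dotProduct {p q : Type*} [Fintype p] [Fintype q] [DecidableEq q]
    (A : Matrix p q ℝ) (x : EuclideanSpace ℝ p) (y : EuclideanSpace ℝ q) :
    inner ℝ x (Matrix.toEuclideanLin A y) =
      (fun ij : p × q => x ij.1 * y ij.2) ⬝ᵥ fun ij : p × q => A ij.1 ij.2 := by
  simp only [PiLp.inner_apply, dotProduct, Fintype.sum_prod_type, Matrix.toLpLin_apply,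
    Matrix.mulVec, RCLike.inner_apply, conj_trivial, Finset.sum_mul]
  exact Finset.sum_congr rfl fun _ _ => Finset.sum_congr rfl fun _ _ => by ring

theorem dotProduct_self_of_mem_sphere {p : Type*} [Fintype p]
    (x : Metric.sphere (0 : EuclideanSpace ℝ p) 1) :
    (fun k => (x : EuclideanSpace ℝ p) k) ⬝ᵥ (fun k => (x : EuclideanSpace ℝ p) k) = 1 := by
  have h : ‖(x : EuclideanSpace ℝ p)‖ ^ 2 = 1 := by simp
  rw [EuclideanSpace.norm_sq_eq] at h
  simpa [dotProduct, sq] using h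

theorem measure_lt_opNorm_le (n₁ n₂ : ℕ) {Ω : Type*} [MeasurableSpace Ω]
    (P : Measure Ω) [IsProbabilityMeasure P] (G : Ω → Matrix (Fin n₁) (Fin n₂) ℝ)
    (hG : Measure.map (fun ω => fun ij : Fin n₁ × Fin n₂ => G ω ij.1 ij.2) P
      = gaussianPi (Fin n₁ × Fin n₂)) {t : ℝ} (ht : 0 < t) :
    P {ω | √n₁ + √n₂ + t < opNorm (G ω)} ≤ ENNReal.ofReal (exp (-t ^ 2 / 2)) := by
  have hs : 0 ≤ √(n₁ : ℝ) + √(n₂ : ℝ) + t := by positivity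
  rcases isEmpty_or_nonempty (Metric.sphere (0 : EuclideanSpace ℝ (Fin n₁)) 1 ×
    Metric.sphere (0 : EuclideanSpace ℝ (Fin n₂)) 1) with hX | hX
  · have : {ω | √n₁ + √n₂ + t < opNorm (G ω)} = ∅ := by
      refine Set.eq_empty_of_forall_notMem fun ω hω => ?_
      obtain ⟨x, -⟩ := exists_unit_lt_inner_of_lt_opNorm hs hω
      exact hX.false x
    simp [this]
  set d := TopologicalSpace.denseSeq (Metric.sphere (0 : EuclideanSpace ℝ (Fin n₁)) 1 ×
    Metric.sphere (0 : EuclideanSpace ℝ (Fin n₂)) 1)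
  set U : Set (Fin n₁ × Fin n₂ → ℝ) := {g | ∃ j, √n₁ + √n₂ + t <
    (fun p : Fin n₁ × Fin n₂ => (d j).1.1 p.1 * (d j).2.1 p.2) ⬝ᵥ g} with hU
  have hUm : MeasurableSet U := by
    rw [hU, Set.ofPred_exists]
    refine MeasurableSet.iUnion fun j => measurableSet_lt measurable_const ?_
    unfold dotProduct
    fun_prop
  have hae : AEMeasurable (fun ω => fun ij : Fin n₁ × Fin n₂ => G ω ij.1 ij.2) P := by
    refine AEMeasurable.of_map_ne_zero ?_
    rw [hG]
    exact IsProbabilityMeasure.ne_zero _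
  have hbound : gaussianPi (Fin n₁ × Fin n₂) U ≤ ENNReal.ofReal (exp (-t ^ 2 / 2)) := by
    have := gaussianPi_exists_nat_lt_dotProduct_le (fun j k => (d j).1.1 k)
      (fun j k => (d j).2.1 k) (fun j => dotProduct_self_of_mem_sphere (d j).1)
      (fun j => dotProduct_self_of_mem_sphere (d j).2) ht
    simpa only [Fintype.card_fin] using this
  refine le_trans ?_ hbound
  rw [← hG, Measure.map_apply_of_aemeasurable hae hUm]
  refine measure_mono fun ω hω => ?_
  have hopen : IsOpen {x : Metric.sphere (0 : EuclideanSpace ℝ (Fin n₁)) 1 ×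
      Metric.sphere (0 : EuclideanSpace ℝ (Fin n₂)) 1 | √n₁ + √n₂ + t <
      inner ℝ (x.1 : EuclideanSpace ℝ (Fin n₁)) (Matrix.toEuclideanLin (G ω) x.2)} := by
    have hcont := (LinearMap.toContinuousLinearMap (Matrix.toEuclideanLin (G ω))).continuous
    rw [LinearMap.coe_toContinuousLinearMap'] at hcont
    refine isOpen_lt continuous_const (Continuous.inner (by fun_prop) (hcont.comp (by fun_prop)))
  obtain ⟨j, hj⟩ := (TopologicalSpace.denseRange_denseSeq _).exists_mem_open hopen
    (exists_unit_lt_inner_of_lt_opNorm hs hω)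
  refine ⟨j, ?_⟩
  rw [Set.mem_ofPred_eq, inner_toEuclideanLin_eq_dotProduct] at hj
  exact hj

/-- If the entries of a random matrix `G ∈ ℝ^{n₁×n₂}` are independent standard
Gaussian, then for every `t > 0`,
`P(‖G‖_op ≥ √n₁ + √n₂ + t) ≤ exp(−t²/2)`. -/
theorem opNorm_gaussian_tail_bound (n₁ n₂ : ℕ) {Ω : Type*} [MeasurableSpace Ω]
    (P : Measure Ω) [IsProbabilityMeasure P]
    (G : Ω → Matrix (Fin n₁) (Fin n₂) ℝ)
    (hG : Measure.map (fun ω => fun ij : Fin n₁ × Fin n₂ => G ω ij.1 ij.2) P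
      = Measure.pi fun _ : Fin n₁ × Fin n₂ => gaussianReal 0 1)
    (t : ℝ) (ht : 0 < t) :
    P {ω | Real.sqrt n₁ + Real.sqrt n₂ + t ≤ opNorm (G ω)}
      ≤ ENNReal.ofReal (Real.exp (-t ^ 2 / 2)) := by
  have hlim : Filter.Tendsto (fun r : ℝ => ENNReal.ofReal (Real.exp (-r ^ 2 / 2)))
      (nhdsWithin t (Set.Ioo 0 t)) (nhds (ENNReal.ofReal (Real.exp (-t ^ 2 / 2)))) := by
    refine ENNReal.tendsto_ofReal (Continuous.continuousWithinAt ?_)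
    fun_prop
  have hne : (nhdsWithin t (Set.Ioo 0 t)).NeBot := by
    rw [nhdsWithin_Ioo_eq_nhdsLT ht]
    infer_instance
  refine ge_of_tendsto hlim (Filter.eventually_of_mem self_mem_nhdsWithin fun r hr => ?_)
  refine (measure_mono fun ω hω => ?_).trans (measure_lt_opNorm_le n₁ n₂ P G hG hr.1)
  rw [Set.mem_ofPred_eq] at hω ⊢
  linarith [hr.2]
end
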